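/- arXiv:2310.00799 — 2 statements merged into one kernel-verified Lean document; each statement's English description precedes it below -/
import Mathlib

section
/- Let 𝔤₁ and 𝔤₂ be finite-dimensional real semisimple Lie algebras of non-compact type, with Iwasawa subalgebras 𝔰₁ ⊆ 𝔤₁ and 𝔰₂ ⊆ 𝔤₂ (each built from a choice of Cartan involution, maximal abelian subspace of the (−1)-eigenspace, and choice of positivity). If 𝔰₁ and 𝔰₂ are isomorphic as real Lie algebras, then 𝔤₁ and 𝔤₂ are isomorphic as real Lie algebras. -/
noncomputable section

variable {g : Type*} [LieRing g] [LieAlgebra ℝ g]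

/-- A Cartan involution of a real Lie algebra: an involutive automorphism `θ` such that
`(X, Y) ↦ -κ(X, θ Y)` is positive definite, where `κ` is the Killing form. -/
def IsCartanInvolution (θ : g ≃ₗ⁅ℝ⁆ g) : Prop :=
  (∀ x, θ (θ x) = x) ∧ ∀ x : g, x ≠ 0 → 0 < -(killingForm ℝ g x (θ x))

/-- The restricted root space of a linear functional `l` on the subspace `a`:
`𝔤_l = {x ∈ 𝔤 | [H, x] = l(H) • x for all H ∈ 𝔞}`. -/
def restrictedRootSpace (a : Submodule ℝ g) (l : Module.Dual ℝ a) : Submodule ℝ g where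
  carrier := {x | ∀ h : a, ⁅(h : g), x⁆ = l h • x}
  add_mem' := by
    intro x y hx hy h
    rw [lie_add, hx h, hy h, smul_add]
  zero_mem' := by intro h; simp
  smul_mem' := by
    intro c x hx h
    rw [lie_smul, hx h, smul_comm]

/-- `a` is a maximal abelian subspace of the `(-1)`-eigenspace `𝔭` of `θ`. -/
def IsMaxAbelianInP (θ : g ≃ₗ⁅ℝ⁆ g) (a : Submodule ℝ g) : Prop :=
  (∀ x ∈ a, θ x = -x) ∧ (∀ x ∈ a, ∀ y ∈ a, ⁅x, y⁆ = 0) ∧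
    ∀ a' : Submodule ℝ g, (∀ x ∈ a', θ x = -x) → (∀ x ∈ a', ∀ y ∈ a', ⁅x, y⁆ = 0) →
      a ≤ a' → a' = a

/-- The set of restricted roots of `a`: nonzero functionals with nonzero root space. -/
def restrictedRoots (a : Submodule ℝ g) : Set (Module.Dual ℝ a) :=
  {l | l ≠ 0 ∧ restrictedRootSpace a l ≠ ⊥}

/-- `H₀` is a regular element of `a`: no restricted root vanishes on it. -/
def IsRegularElt (a : Submodule ℝ g) (H₀ : a) : Prop :=
  ∀ l ∈ restrictedRoots a, l H₀ ≠ 0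

/-- The positive restricted roots `Σ⁺` determined by the regular element `H₀`. -/
def posRestrictedRoots (a : Submodule ℝ g) (H₀ : a) : Set (Module.Dual ℝ a) :=
  {l ∈ restrictedRoots a | 0 < l H₀}

/-- The nilpotent Iwasawa part `𝔫 = ⊕_{λ ∈ Σ⁺} 𝔤_λ`. -/
def iwasawaNilpart (a : Submodule ℝ g) (H₀ : a) : Submodule ℝ g :=
  ⨆ l ∈ posRestrictedRoots a H₀, restrictedRootSpace a l

/-- `𝔤` is of non-compact type (relative to the Cartan involution `θ`): no nonzero Lie ideal
is contained in the fixed-point subalgebra `𝔨` of `θ`. -/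
def IsNoncompactType (θ : g ≃ₗ⁅ℝ⁆ g) : Prop :=
  ∀ I : LieIdeal ℝ g, (∀ x ∈ I, θ x = x) → I = ⊥

/-- `s` is an Iwasawa subalgebra of the non-compact type semisimple algebra `g`, i.e.
`s = 𝔞 ⊕ 𝔫` for some Cartan involution `θ`, maximal abelian subspace `𝔞` of `𝔭`, and
choice of positivity (with `𝔤` of non-compact type relative to `θ`). -/
def IsIwasawaSubalgebraNC (s : LieSubalgebra ℝ g) : Prop :=
  ∃ (θ : g ≃ₗ⁅ℝ⁆ g) (a : Submodule ℝ g) (H₀ : a),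
    IsCartanInvolution θ ∧ IsMaxAbelianInP θ a ∧ IsRegularElt a H₀ ∧ IsNoncompactType θ ∧
      (s : Submodule ℝ g) = a ⊔ iwasawaNilpart a H₀

section LinearAlgebra

variable {V : Type*} [AddCommGroup V] [Module ℝ V]

/-- Simultaneous diagonalisation of a positive definite form and a symmetric form. -/
theorem exists_basis_orthonormal_diagonal [Module.Finite ℝ V] (P Q : V →ₗ[ℝ] V →ₗ[ℝ] ℝ)
    (hP : ∀ x y, P x y = P y x) (hpos : ∀ x, x ≠ 0 → 0 < P x x) (hQ : ∀ x y, Q x y = Q y x) :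
    ∃ (n : ℕ) (b : Module.Basis (Fin n) ℝ V) (s : Fin n → ℝ),
      (∀ i j, P (b i) (b j) = if i = j then 1 else 0) ∧
      (∀ i x, Q (b i) x = s i * P (b i) x) := by
  let core : InnerProductSpace.Core ℝ V :=
    { inner := fun x y => P x y
      conj_inner_symm := fun x y => by simpa using hP y x
      re_inner_nonneg := fun x => by
        rcases eq_or_ne x 0 with rfl | hx
        · simp
        · simpa using (hpos x hx).le
      add_left := fun x y z => by simp
      smul_left := fun x y r => by simp
      definite := fun x hx => by
        by_contra h
        exact (hpos x h).ne' hx }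
  let _ : NormedAddCommGroup V := @InnerProductSpace.Core.toNormedAddCommGroup ℝ V _ _ _ core
  let _ : InnerProductSpace ℝ V := InnerProductSpace.ofCore core.toCore
  have hin : ∀ x y : V, inner ℝ x y = P x y := fun x y => rfl
  have hPinj : Function.Injective P := by
    rw [injective_iff_map_eq_zero]
    intro x hx
    by_contra h
    have := hpos x h
    simp [hx] at this
  have hPsurj : Function.Surjective P :=
    (LinearMap.injective_iff_surjective_of_finrank_eq_finrank
      (Subspace.dual_finrank_eq (K := ℝ) (V := V)).symm).1 hPinj
  let e : V ≃ₗ[ℝ] Module.Dual ℝ V := LinearEquiv.ofBijective P ⟨hPinj, hPsurj⟩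
  let T : V →ₗ[ℝ] V := e.symm.toLinearMap ∘ₗ Q
  have hT : ∀ x y, P (T x) y = Q x y := fun x y => by
    have : e (e.symm (Q x)) = Q x := e.apply_symm_apply _
    exact congrArg (fun f : V →ₗ[ℝ] ℝ => f y) this
  have hsymm : T.IsSymmetric := fun x y => by
    rw [hin, hin, hT, hP, hT, hQ]
  refine ⟨Module.finrank ℝ V, (hsymm.eigenvectorBasis rfl).toBasis, hsymm.eigenvalues rfl,
    fun i j => ?_, fun i x => ?_⟩
  · have := (orthonormal_iff_ite.1 (hsymm.eigenvectorBasis rfl).orthonormal) i j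
    simpa [hin] using this
  · rw [← hT, OrthonormalBasis.coe_toBasis, hsymm.apply_eigenvectorBasis rfl]
    simp

/-- An orthonormal family spanning a subspace. -/
theorem exists_orthonormal_family [Module.Finite ℝ V] (P : V →ₗ[ℝ] V →ₗ[ℝ] ℝ)
    (hP : ∀ x y, P x y = P y x) (hpos : ∀ x, x ≠ 0 → 0 < P x x) (W : Submodule ℝ V) :
    ∃ (n : ℕ) (b : Fin n → V), (∀ i, b i ∈ W) ∧
      (∀ i j, P (b i) (b j) = if i = j then 1 else 0) ∧
      ∀ x ∈ W, x = ∑ i, P (b i) x • b i := by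
  obtain ⟨n, b, -, hb, -⟩ := exists_basis_orthonormal_diagonal (V := W)
    (P.compl₁₂ W.subtype W.subtype) 0
    (fun x y => hP _ _) (fun x hx => hpos _ (by simpa using hx)) (fun _ _ => rfl)
  refine ⟨n, fun i => b i, fun i => (b i).2, fun i j => by simpa using hb i j, fun x hx => ?_⟩
  have h1 := b.sum_repr ⟨x, hx⟩
  have h2 : ∀ i, P (b i) x = b.repr ⟨x, hx⟩ i := fun i => by
    have h3 : ∀ i j, P (b i : V) (b j : V) = if i = j then 1 else 0 := fun i j => by
      simpa using hb i j
    have h5 : P (b i) (W.subtype (∑ j, b.repr ⟨x, hx⟩ j • b j)) = b.repr ⟨x, hx⟩ i := by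
      simp only [map_sum, map_smul, Submodule.subtype_apply, h3]
      simp
    rwa [h1] at h5
  have h4 : x = W.subtype (∑ j, b.repr ⟨x, hx⟩ j • b j) := by rw [h1]; rfl
  simp only [h2]
  refine h4.trans ?_
  simp only [map_sum, map_smul, Submodule.subtype_apply]

/-- The operator `x ↦ ∑ i, P (b i) x • b i`; the orthogonal projection onto the span of `b` if
`b` is orthonormal for `P`. -/
def familyProj {ι : Type*} [Fintype ι] (P : V →ₗ[ℝ] V →ₗ[ℝ] ℝ) (b : ι → V) : V →ₗ[ℝ] V :=
  ∑ i, (P (b i)).smulRight (b i)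

theorem familyProj_apply {ι : Type*} [Fintype ι] (P : V →ₗ[ℝ] V →ₗ[ℝ] ℝ) (b : ι → V) (x : V) :
    familyProj P b x = ∑ i, P (b i) x • b i := by
  simp [familyProj]

theorem trace_comp_familyProj [Module.Finite ℝ V] {ι : Type*} [Fintype ι]
    (P : V →ₗ[ℝ] V →ₗ[ℝ] ℝ) (b : ι → V) (f : V →ₗ[ℝ] V) :
    LinearMap.trace ℝ V (f * familyProj P b) = ∑ i, P (b i) (f (b i)) := by
  have : f * familyProj P b = ∑ i, (P (b i)).smulRight (f (b i)) := by
    ext x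
    simp [familyProj_apply]
  rw [this, map_sum]
  exact Finset.sum_congr rfl fun i _ => LinearMap.trace_smulRight _ _

/-- Let `c` be antisymmetric structure constants and `s` a positive rescaling. If rescaling preserves
the Ricci-type diagonal in every direction with `s i ≠ 1`, then `s` is multiplicative along the
nonzero structure constants. -/
theorem scale_eq_mul_of_balanced {ι : Type*} [Fintype ι] (c : ι → ι → ι → ℝ) (s : ι → ℝ)
    (hs : ∀ i, 0 < s i) (hc : ∀ i j k, c i j k = - c j i k)
    (h : ∀ i, s i ≠ 1 →
      ∑ j, ∑ k, c j k i ^ 2 - 2 * ∑ j, ∑ k, c i j k ^ 2 =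
      ∑ j, ∑ k, c j k i ^ 2 * (s i / (s j * s k))
        - 2 * ∑ j, ∑ k, c i j k ^ 2 * (s k / (s i * s j))) :
    ∀ i j k, c i j k ≠ 0 → s k = s i * s j := by
  set w : ι → ι → ι → ℝ := fun i j k => s k / (s i * s j) with hw
  have hwpos : ∀ i j k, 0 < w i j k := fun i j k => div_pos (hs k) (mul_pos (hs i) (hs j))
  have hlog : ∀ i j k, Real.log (w i j k) = Real.log (s k) - Real.log (s i) - Real.log (s j) := by
    intro i j k
    rw [hw, Real.log_div (hs k).ne' (mul_pos (hs i) (hs j)).ne',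
      Real.log_mul (hs i).ne' (hs j).ne']
    ring
  have hterm : ∀ i j k, 0 ≤ c i j k ^ 2 * ((w i j k - 1) * Real.log (w i j k)) := by
    intro i j k
    refine mul_nonneg (sq_nonneg _) ?_
    rcases le_total 1 (w i j k) with h1 | h1
    · exact mul_nonneg (by linarith) (Real.log_nonneg h1)
    · exact mul_nonneg_of_nonpos_of_nonpos (by linarith)
        (Real.log_nonpos (hwpos i j k).le h1)
  have hd : ∀ i, Real.log (s i) * (∑ j, ∑ k, c j k i ^ 2 * (w j k i - 1)
      - 2 * ∑ j, ∑ k, c i j k ^ 2 * (w i j k - 1)) = 0 := by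
    intro i
    by_cases h1 : s i = 1
    · simp [h1]
    · have := h i h1
      simp only [mul_sub (_ ^ 2 : ℝ), mul_one, Finset.sum_sub_distrib, mul_sub (2 : ℝ)]
      have h2 : ∑ j, ∑ k, c j k i ^ 2 * w j k i - ∑ j, ∑ k, c j k i ^ 2 -
        (2 * ∑ j, ∑ k, c i j k ^ 2 * w i j k - 2 * ∑ j, ∑ k, c i j k ^ 2) = 0 := by
        simp only [hw]
        linarith
      rw [h2, mul_zero]
  have hsum : ∑ i, ∑ j, ∑ k, c i j k ^ 2 * ((w i j k - 1) * Real.log (w i j k)) = 0 := by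
    have e1 : ∑ i, ∑ j, ∑ k, c i j k ^ 2 * ((w i j k - 1) * Real.log (w i j k)) =
        ∑ i, ∑ j, ∑ k, Real.log (s k) * (c i j k ^ 2 * (w i j k - 1))
        - ∑ i, ∑ j, ∑ k, Real.log (s i) * (c i j k ^ 2 * (w i j k - 1))
        - ∑ i, ∑ j, ∑ k, Real.log (s j) * (c i j k ^ 2 * (w i j k - 1)) := by
      simp only [← Finset.sum_sub_distrib]
      refine Finset.sum_congr rfl fun i _ => Finset.sum_congr rfl fun j _ =>
        Finset.sum_congr rfl fun k _ => ?_
      rw [hlog]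
      ring
    have e2 : ∑ i, ∑ j, ∑ k, Real.log (s j) * (c i j k ^ 2 * (w i j k - 1)) =
        ∑ i, ∑ j, ∑ k, Real.log (s i) * (c i j k ^ 2 * (w i j k - 1)) := by
      rw [Finset.sum_comm]
      refine Finset.sum_congr rfl fun i _ => Finset.sum_congr rfl fun j _ =>
        Finset.sum_congr rfl fun k _ => ?_
      rw [hc j i k]
      simp only [hw, mul_comm (s j) (s i), neg_sq]
    have e3 : ∑ i, ∑ j, ∑ k, Real.log (s k) * (c i j k ^ 2 * (w i j k - 1)) =
        ∑ i, ∑ j, ∑ k, Real.log (s i) * (c j k i ^ 2 * (w j k i - 1)) := by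
      calc _ = ∑ i, ∑ k, ∑ j, Real.log (s k) * (c i j k ^ 2 * (w i j k - 1)) :=
            Finset.sum_congr rfl fun i _ => Finset.sum_comm
        _ = _ := Finset.sum_comm
    rw [e1, e2, e3]
    have := Finset.sum_eq_zero (s := Finset.univ) fun i _ => hd i
    simp only [mul_sub, Finset.sum_sub_distrib, Finset.mul_sum] at this ⊢
    have e4 : ∀ f : ι → ι → ι → ℝ, ∑ i, ∑ j, ∑ k, Real.log (s i) * (2 * f i j k) =
        2 * ∑ i, ∑ j, ∑ k, Real.log (s i) * f i j k := fun f => by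
      simp only [Finset.mul_sum]
      refine Finset.sum_congr rfl fun i _ => Finset.sum_congr rfl fun j _ =>
        Finset.sum_congr rfl fun k _ => by ring
    simp only [e4] at this
    linarith
  intro i j k hne
  have h0 := (Finset.sum_eq_zero_iff_of_nonneg fun i _ => Finset.sum_nonneg fun j _ =>
    Finset.sum_nonneg fun k _ => hterm i j k).1 hsum i (Finset.mem_univ _)
  have h1 := (Finset.sum_eq_zero_iff_of_nonneg fun j _ =>
    Finset.sum_nonneg fun k _ => hterm i j k).1 h0 j (Finset.mem_univ _)
  have h2 := (Finset.sum_eq_zero_iff_of_nonneg fun k _ => hterm i j k).1 h1 k (Finset.mem_univ _)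
  have h3 : w i j k = 1 := by
    rcases mul_eq_zero.1 h2 with h | h
    · exact absurd (pow_eq_zero_iff two_ne_zero |>.1 h) hne
    · rcases mul_eq_zero.1 h with h | h
      · linarith
      · rcases Real.log_eq_zero.1 h with h | h | h <;> linarith [hwpos i j k]
  have := (div_eq_one_iff_eq (mul_pos (hs i) (hs j)).ne').1 h3
  exact this

end LinearAlgebra

section CartanForm

/-- The symmetric bilinear form `(x, y) ↦ -κ(x, θ y)`. -/
def cartanForm (θ : g ≃ₗ⁅ℝ⁆ g) : g →ₗ[ℝ] g →ₗ[ℝ] ℝ :=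
  -((killingForm ℝ g).compl₂ (θ : g →ₗ[ℝ] g))

theorem cartanForm_apply (θ : g ≃ₗ⁅ℝ⁆ g) (x y : g) :
    cartanForm θ x y = -(killingForm ℝ g x (θ y)) := rfl

theorem killingForm_symm (x y : g) : killingForm ℝ g x y = killingForm ℝ g y x :=
  LieModule.traceForm_comm ℝ g g x y

theorem killingForm_lie_left (x y z : g) :
    killingForm ℝ g ⁅x, y⁆ z = -killingForm ℝ g y ⁅x, z⁆ :=
  LieModule.traceForm_apply_lie_apply' ℝ g g x y z

theorem cartanForm_map (θ : g ≃ₗ⁅ℝ⁆ g) (x y : g) : cartanForm θ (θ x) (θ y) = cartanForm θ x y := by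
  rw [cartanForm_apply, cartanForm_apply, LieAlgebra.killingForm_of_equiv_apply]

namespace IsCartanInvolution

variable {θ : g ≃ₗ⁅ℝ⁆ g} (hθ : IsCartanInvolution θ)
include hθ

theorem form_symm (x y : g) : cartanForm θ x y = cartanForm θ y x := by
  rw [cartanForm_apply, cartanForm_apply, killingForm_symm y,
    ← LieAlgebra.killingForm_of_equiv_apply θ x, hθ.1]

theorem form_pos (x : g) (hx : x ≠ 0) : 0 < cartanForm θ x x := hθ.2 x hx

theorem eq_zero_of_form (x : g) (hx : cartanForm θ x x = 0) : x = 0 := by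
  by_contra h
  exact (hθ.form_pos x h).ne' hx

theorem eq_of_form {x y : g} (h : ∀ z, cartanForm θ x z = cartanForm θ y z) : x = y := by
  rw [← sub_eq_zero]
  apply hθ.eq_zero_of_form
  rw [LinearMap.map_sub₂, h, sub_self]

theorem form_lie (x y z : g) : cartanForm θ ⁅x, y⁆ z = -cartanForm θ y ⁅θ x, z⁆ := by
  rw [cartanForm_apply, cartanForm_apply, killingForm_lie_left, LieEquiv.map_lie, hθ.1]

theorem form_lie_neg {h : g} (hh : θ h = -h) (y z : g) :
    cartanForm θ ⁅h, y⁆ z = cartanForm θ y ⁅h, z⁆ := by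
  rw [hθ.form_lie, hh, neg_lie, map_neg, neg_neg]

/-- Elements of the `(-1)`-eigenspace act diagonalisably. -/
theorem exists_eigenbasis [Module.Finite ℝ g] {h : g} (hh : θ h = -h) :
    ∃ (n : ℕ) (b : Module.Basis (Fin n) ℝ g) (s : Fin n → ℝ), ∀ i, ⁅h, b i⁆ = s i • b i := by
  obtain ⟨n, b, s, -, hb⟩ := exists_basis_orthonormal_diagonal (cartanForm θ)
    (cartanForm θ ∘ₗ (LieAlgebra.ad ℝ g h : g →ₗ[ℝ] g)) hθ.form_symm hθ.form_pos
    (fun x y => by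
      simp only [LinearMap.comp_apply, LieAlgebra.ad_apply]
      rw [hθ.form_lie_neg hh, hθ.form_symm])
  refine ⟨n, b, s, fun i => hθ.eq_of_form fun z => ?_⟩
  simpa using hb i z

theorem pow_ad_eq_zero {h : g} (hh : θ h = -h) (μ : ℝ) (v : g) (k : ℕ)
    (hk : (((LieAlgebra.ad ℝ g h : Module.End ℝ g) - μ • 1) ^ k) v = 0) : ⁅h, v⁆ = μ • v := by
  set T : Module.End ℝ g := (LieAlgebra.ad ℝ g h : Module.End ℝ g) - μ • 1 with hT
  have hsymm : ∀ x y, cartanForm θ (T x) y = cartanForm θ x (T y) := fun x y => by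
    simp [hT, hθ.form_lie_neg hh]
  have hsuff : T v = 0 := by
    induction k with
    | zero => simp_all
    | succ k ih =>
      rcases k with _ | k
      · simpa using hk
      · apply ih
        apply hθ.eq_zero_of_form
        have e : (T ^ (k + 1)) v = T ((T ^ k) v) := by rw [pow_succ', Module.End.mul_apply]
        conv_lhs => rw [e]
        rw [hsymm, ← e, ← Module.End.mul_apply, ← pow_succ', hk, map_zero]
  rw [← sub_eq_zero]
  simpa [hT] using hsuff

/-- Simultaneous diagonalisation under an abelian subspace of `𝔭`. -/
theorem iSup_restrictedRootSpace [Module.Finite ℝ g] (a : Submodule ℝ g)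
    (ha : ∀ x ∈ a, θ x = -x) (hab : ∀ x ∈ a, ∀ y ∈ a, ⁅x, y⁆ = 0) :
    ⨆ l : Module.Dual ℝ a, restrictedRootSpace a l = ⊤ := by
  have key := Module.End.iSup_iInf_maxGenEigenspace_eq_top_of_iSup_maxGenEigenspace_eq_top_of_commute
    (fun h : a => (LieAlgebra.ad ℝ g (h : g) : Module.End ℝ g))
    (fun x y _ => by
      refine LinearMap.ext fun v => ?_
      simp only [Module.End.mul_apply, LieAlgebra.ad_apply]
      rw [leibniz_lie, hab _ x.2 _ y.2, zero_lie, zero_add])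
    (fun h => by
      obtain ⟨n, b, s, hb⟩ := hθ.exists_eigenbasis (ha h h.2)
      rw [eq_top_iff, ← b.span_eq, Submodule.span_le]
      rintro _ ⟨i, rfl⟩
      refine Submodule.mem_iSup_of_mem (s i) ?_
      rw [Module.End.mem_maxGenEigenspace]
      refine ⟨1, ?_⟩
      simp [hb])
  rw [eq_top_iff, ← key, iSup_le_iff]
  intro χ v hv
  have hv' : ∀ h : a, ⁅(h : g), v⁆ = χ h • v := fun h => by
    have := (Submodule.mem_iInf _).1 hv h
    rw [Module.End.mem_maxGenEigenspace] at this
    obtain ⟨k, hk⟩ := this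
    exact hθ.pow_ad_eq_zero (ha h h.2) _ _ k hk
  rcases eq_or_ne v 0 with rfl | hne
  · exact Submodule.zero_mem _
  · let l : Module.Dual ℝ a :=
      { toFun := χ
        map_add' := fun x y => smul_left_injective ℝ hne (by
          simp only [add_smul, ← hv']
          simp)
        map_smul' := fun c x => smul_left_injective ℝ hne (by
          simp only [← hv', smul_eq_mul, mul_smul, RingHom.id_apply]
          simp) }
    exact Submodule.mem_iSup_of_mem l hv'

end IsCartanInvolution

end CartanForm

section RootSup

/-- The sum of the restricted root spaces with functional in a set. -/
def rootSup (a : Submodule ℝ g) (S : Set (Module.Dual ℝ a)) : Submodule ℝ g :=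
  ⨆ l ∈ S, restrictedRootSpace a l

theorem rootSup_le {a : Submodule ℝ g} {S : Set (Module.Dual ℝ a)} {W : Submodule ℝ g} :
    rootSup a S ≤ W ↔ ∀ l ∈ S, ∀ x, (∀ h : a, ⁅(h : g), x⁆ = l h • x) → x ∈ W :=
  iSup₂_le_iff

theorem mem_rootSup {a : Submodule ℝ g} {S : Set (Module.Dual ℝ a)} {l : Module.Dual ℝ a}
    (hl : l ∈ S) {x : g} (hx : ∀ h : a, ⁅(h : g), x⁆ = l h • x) : x ∈ rootSup a S :=
  rootSup_le.1 le_rfl l hl x hx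

theorem lie_mem_rootSup {a : Submodule ℝ g} {S S' S'' : Set (Module.Dual ℝ a)}
    (h : ∀ l ∈ S, ∀ m ∈ S', l + m ∈ S'') {x y : g} (hx : x ∈ rootSup a S)
    (hy : y ∈ rootSup a S') : ⁅x, y⁆ ∈ rootSup a S'' := by
  have h1 : rootSup a S ≤ (rootSup a S'').comap ((LieAlgebra.ad ℝ g : g →ₗ[ℝ] g →ₗ[ℝ] g).flip y) := by
    refine rootSup_le.2 fun l hl x hx => ?_
    have h2 : rootSup a S' ≤ (rootSup a S'').comap (LieAlgebra.ad ℝ g x) := by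
      refine rootSup_le.2 fun m hm y hy => ?_
      refine mem_rootSup (h l hl m hm) fun H => ?_
      rw [LieAlgebra.ad_apply, leibniz_lie, hx, hy, smul_lie, lie_smul, LinearMap.add_apply, add_smul]
    exact h2 hy
  exact h1 hx

end RootSup

/-- The structural consequences of an Iwasawa decomposition `𝔤 = 𝔫 ⊕ 𝔤₀ ⊕ θ𝔫`. -/
structure IwasawaDecomp (θ : g ≃ₗ⁅ℝ⁆ g) (a n : Submodule ℝ g) (H : g) : Prop where
  cartan : IsCartanInvolution θ
  mem : H ∈ a
  theta_neg : ∀ x ∈ a, θ x = -x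
  lie_a_a : ∀ x ∈ a, ∀ y ∈ a, ⁅x, y⁆ = 0
  lie_n_n : ∀ x ∈ n, ∀ y ∈ n, ⁅x, y⁆ ∈ n
  lie_zero_n : ∀ z : g, ⁅H, z⁆ = 0 → ∀ x ∈ n, ⁅z, x⁆ ∈ n
  lie_a_zero : ∀ z : g, ⁅H, z⁆ = 0 → ∀ x ∈ a, ⁅x, z⁆ = 0
  mem_a : ∀ z : g, ⁅H, z⁆ = 0 → θ z = -z → z ∈ a
  decomp : ∀ x : g, ∃ u ∈ n, ∃ z : g, ⁅H, z⁆ = 0 ∧ ∃ v ∈ n, x = u + z + θ v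
  surj : ∀ x ∈ n, ∃ y ∈ n, x = ⁅H, y⁆
  killing_n : ∀ x ∈ n, ∀ y ∈ n, killingForm ℝ g x y = 0
  filtration : ∃ (F : ℕ → Submodule ℝ g) (K : ℕ), F 0 = n ∧ (∀ k, F k ≤ n) ∧ F K = ⊥ ∧
    (∀ k, F (k + 1) ≤ F k) ∧ (∀ k, ∀ x ∈ n, ∀ y ∈ F k, ⁅x, y⁆ ∈ F (k + 1)) ∧
    ∀ k, ∀ x ∈ a, ∀ y ∈ F k, ⁅x, y⁆ ∈ F k

theorem IwasawaDecomp.of_isMaxAbelianInP [Module.Finite ℝ g] {θ : g ≃ₗ⁅ℝ⁆ g} {a : Submodule ℝ g}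
    {H₀ : a} (hθ : IsCartanInvolution θ) (ha : IsMaxAbelianInP θ a) (hH : IsRegularElt a H₀) :
    IwasawaDecomp θ a (iwasawaNilpart a H₀) H₀ := by
  obtain ⟨ha1, ha2, ha3⟩ := ha
  have hn : iwasawaNilpart a H₀ = rootSup a {l | 0 < l H₀} := by
    apply le_antisymm
    · exact iSup₂_le fun l hl => le_iSup₂_of_le (i := l) hl.2 le_rfl
    · refine iSup₂_le fun l hl => ?_
      by_cases hb : restrictedRootSpace a l = ⊥
      · rw [hb]
        exact bot_le
      · refine le_iSup₂_of_le (i := l) ⟨⟨?_, hb⟩, hl⟩ le_rfl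
        rintro rfl
        simp at hl
  rw [hn]
  have hzero : ∀ z ∈ rootSup a {l | l H₀ = 0}, ∀ h : a, ⁅(h : g), z⁆ = 0 := by
    intro z hz h
    have : rootSup a {l | l H₀ = 0} ≤ LinearMap.ker (LieAlgebra.ad ℝ g (h : g)) := by
      refine rootSup_le.2 fun l hl x hx => ?_
      rw [LinearMap.mem_ker, LieAlgebra.ad_apply, hx]
      by_cases hb : restrictedRootSpace a l = ⊥
      · have hx' : x ∈ restrictedRootSpace a l := hx
        rw [hb, Submodule.mem_bot] at hx'
        rw [hx', smul_zero]
      · by_cases hl0 : l = 0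
        · simp [hl0]
        · exact absurd hl (hH l ⟨hl0, hb⟩)
    exact this hz
  have hneg : rootSup a {l | l H₀ < 0} ≤ (rootSup a {l | 0 < l H₀}).comap (θ : g →ₗ[ℝ] g) := by
    refine rootSup_le.2 fun l hl x hx => ?_
    refine mem_rootSup (l := -l) (by simpa using hl) fun h => ?_
    have h1 : θ ⁅(h : g), x⁆ = -⁅(h : g), θ x⁆ := by
      rw [LieEquiv.map_lie, ha1 _ h.2, neg_lie]
    have h2 : ⁅(h : g), θ x⁆ = -θ ⁅(h : g), x⁆ := by rw [h1, neg_neg]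
    change ⁅(h : g), θ x⁆ = _ • θ x
    rw [h2, hx]
    simp
  have hdec : ∀ x, ∃ u ∈ rootSup a {l | 0 < l H₀}, ∃ z, (∀ h : a, ⁅(h : g), z⁆ = 0) ∧
      ∃ v ∈ rootSup a {l | 0 < l H₀}, x = u + z + θ v := by
    intro x
    have hx : x ∈ (⊤ : Submodule ℝ g) := trivial
    rw [← hθ.iSup_restrictedRootSpace a ha1 ha2] at hx
    have hle : ⨆ l : Module.Dual ℝ a, restrictedRootSpace a l ≤
        rootSup a {l | 0 < l H₀} ⊔ rootSup a {l | l H₀ = 0} ⊔ rootSup a {l | l H₀ < 0} := by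
      refine iSup_le fun l y hy => ?_
      rcases lt_trichotomy (l H₀) 0 with h | h | h
      · exact Submodule.mem_sup_right (mem_rootSup h hy)
      · exact Submodule.mem_sup_left (Submodule.mem_sup_right (mem_rootSup h hy))
      · exact Submodule.mem_sup_left (Submodule.mem_sup_left (mem_rootSup h hy))
    obtain ⟨y, hy, v, hv, rfl⟩ := Submodule.mem_sup.1 (hle hx)
    obtain ⟨u, hu, z, hz, rfl⟩ := Submodule.mem_sup.1 hy
    exact ⟨u, hu, z, hzero z hz, θ v, hneg hv, by rw [hθ.1]⟩
  have hsurj : ∀ x ∈ rootSup a {l | 0 < l H₀}, ∃ y ∈ rootSup a {l | 0 < l H₀},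
      x = ⁅(H₀ : g), y⁆ := by
    intro x hx
    have : rootSup a {l | 0 < l H₀} ≤
        (rootSup a {l | 0 < l H₀}).map (LieAlgebra.ad ℝ g (H₀ : g) : g →ₗ[ℝ] g) := by
      refine rootSup_le.2 fun l hl x hx => ⟨(l H₀)⁻¹ • x, ?_, ?_⟩
      · exact Submodule.smul_mem _ _ (mem_rootSup hl hx)
      · have hl' : 0 < l H₀ := hl
        simp [hx, smul_smul, inv_mul_cancel₀ hl'.ne']
    obtain ⟨y, hy, rfl⟩ := this hx
    exact ⟨y, hy, rfl⟩
  have hcent : ∀ z : g, ⁅(H₀ : g), z⁆ = 0 → ∀ h : a, ⁅(h : g), z⁆ = 0 := by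
    intro z hz
    obtain ⟨u, hu, z', hz', v, hv, rfl⟩ := hdec z
    have h1 : ⁅(H₀ : g), u + θ v⁆ = 0 := by
      have h2 := hz' H₀
      simp only [lie_add, h2, add_zero] at hz ⊢
      exact hz
    suffices u + θ v = 0 by
      have e : u + z' + θ v = z' + (u + θ v) := by abel
      rw [e, this, add_zero]
      exact hz'
    have h3 : ∃ w, u + θ v = ⁅(H₀ : g), w⁆ := by
      obtain ⟨y, -, hy⟩ := hsurj u hu
      obtain ⟨y', -, hy'⟩ := hsurj v hv
      refine ⟨y - θ y', ?_⟩
      rw [hy, hy', LieEquiv.map_lie, ha1 _ H₀.2, lie_sub, neg_lie, sub_eq_add_neg]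
    obtain ⟨w, hw⟩ := h3
    apply hθ.eq_zero_of_form
    conv_lhs => rw [hw]
    rw [hθ.form_lie_neg (ha1 _ H₀.2), ← hw, h1, map_zero]
  refine ⟨hθ, H₀.2, ha1, ha2, ?_, ?_, ?_, ?_, ?_, hsurj, ?_, ?_⟩
  · intro x hx y hy
    refine lie_mem_rootSup (S := {l | 0 < l H₀}) (S' := {l | 0 < l H₀})
      (fun l hl m hm => ?_) hx hy
    simp only [Set.mem_ofPred_eq, LinearMap.add_apply] at hl hm ⊢
    exact add_pos hl hm
  · intro z hz x hx
    refine lie_mem_rootSup (S := {0}) (S' := {l | 0 < l H₀}) (fun l hl m hm => ?_) (mem_rootSup (Set.mem_singleton _) fun h => ?_) hx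
    · rw [Set.mem_singleton_iff.1 hl, zero_add]
      exact hm
    · simp [hcent z hz h]
  · intro z hz x hx
    exact hcent z hz ⟨x, hx⟩
  · intro z hz hzθ
    have := ha3 (a ⊔ Submodule.span ℝ {z}) ?_ ?_ le_sup_left
    · rw [← this]
      exact Submodule.mem_sup_right (Submodule.mem_span_singleton_self z)
    · intro x hx
      obtain ⟨y, hy, w, hw, rfl⟩ := Submodule.mem_sup.1 hx
      obtain ⟨c, rfl⟩ := Submodule.mem_span_singleton.1 hw
      rw [map_add, map_smul, ha1 y hy, hzθ, smul_neg, neg_add]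
    · intro x hx x' hx'
      obtain ⟨y, hy, w, hw, rfl⟩ := Submodule.mem_sup.1 hx
      obtain ⟨c, rfl⟩ := Submodule.mem_span_singleton.1 hw
      obtain ⟨y', hy', w', hw', rfl⟩ := Submodule.mem_sup.1 hx'
      obtain ⟨c', rfl⟩ := Submodule.mem_span_singleton.1 hw'
      have e1 := hcent z hz ⟨y, hy⟩
      have e2 := hcent z hz ⟨y', hy'⟩
      have e3 : ⁅z, y'⁆ = 0 := by rw [← lie_skew, e2, neg_zero]
      simp only at e1
      simp [ha2 y hy y' hy', e1, e3]
  · intro x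
    obtain ⟨u, hu, z, hz, v, hv, h⟩ := hdec x
    exact ⟨u, hu, z, hz H₀, v, hv, h⟩
  · intro x hx y hy
    have h1 : rootSup a {l | 0 < l H₀} ≤ LinearMap.ker ((killingForm ℝ g).flip y) := by
      refine rootSup_le.2 fun l hl x hx => ?_
      have h2 : rootSup a {l | 0 < l H₀} ≤ LinearMap.ker (killingForm ℝ g x) := by
        refine rootSup_le.2 fun m hm y hy => ?_
        rw [LinearMap.mem_ker]
        have h3 := killingForm_lie_left (H₀ : g) x y
        rw [hx, hy] at h3
        simp only [map_smul, LinearMap.smul_apply, smul_eq_mul] at h3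
        have hl' : 0 < l H₀ := hl
        have hm' : 0 < m H₀ := hm
        have h4 : (l H₀ + m H₀) * killingForm ℝ g x y = 0 := by linarith
        exact (mul_eq_zero.1 h4).resolve_left (add_pos hl' hm').ne'
      exact h2 hy
    exact h1 hx
  · have hfin : Set.Finite {μ : ℝ | Module.End.HasEigenvalue (LieAlgebra.ad ℝ g (H₀ : g)) μ} :=
      Module.End.finite_hasEigenvalue _
    have hev : ∀ l : Module.Dual ℝ a, ∀ x : g, (∀ h : a, ⁅(h : g), x⁆ = l h • x) → x ≠ 0 →
        l H₀ ∈ {μ : ℝ | Module.End.HasEigenvalue (LieAlgebra.ad ℝ g (H₀ : g)) μ} := by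
      intro l x hx hx0
      exact Module.End.hasEigenvalue_of_hasEigenvector (x := x)
        ⟨Module.End.mem_eigenspace_iff.2 (hx H₀), hx0⟩
    obtain ⟨ε, hε, hε'⟩ : ∃ ε > 0, ∀ μ ∈ {μ : ℝ | Module.End.HasEigenvalue
        (LieAlgebra.ad ℝ g (H₀ : g)) μ}, 0 < μ → ε ≤ μ := by
      rcases ({μ ∈ hfin.toFinset | 0 < μ} : Finset ℝ).eq_empty_or_nonempty with he | hne
      · refine ⟨1, one_pos, fun μ hμ h0 => ?_⟩
        have : μ ∈ ({μ ∈ hfin.toFinset | 0 < μ} : Finset ℝ) :=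
          Finset.mem_filter.2 ⟨hfin.mem_toFinset.2 hμ, h0⟩
        rw [he] at this
        exact absurd this (Finset.notMem_empty _)
      · exact ⟨Finset.min' _ hne, (Finset.mem_filter.1 (Finset.min'_mem _ hne)).2,
          fun μ hμ h0 => Finset.min'_le _ _ (Finset.mem_filter.2 ⟨hfin.mem_toFinset.2 hμ, h0⟩)⟩
    obtain ⟨M, hM⟩ := hfin.bddAbove
    obtain ⟨K, hK⟩ := exists_nat_gt (M / ε)
    refine ⟨fun k => rootSup a {l | (k + 1) * ε ≤ l H₀}, K, ?_, fun k => ?_, ?_, fun k => ?_,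
      ?_, ?_⟩
    · apply le_antisymm
      · refine rootSup_le.2 fun l hl x hx => mem_rootSup (l := l) ?_ hx
        simp only [CharP.cast_eq_zero, zero_add, one_mul, Set.mem_ofPred_eq] at hl
        exact hε.trans_le hl
      · refine rootSup_le.2 fun l hl x hx => ?_
        rcases eq_or_ne x 0 with rfl | h0
        · exact Submodule.zero_mem _
        · refine mem_rootSup (l := l) ?_ hx
          simpa using hε' _ (hev l x hx h0) hl
    · refine rootSup_le.2 fun l hl x hx => mem_rootSup (l := l) ?_ hx
      have hl' : ((k : ℝ) + 1) * ε ≤ l H₀ := hl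
      have h0 : 0 < ((k : ℝ) + 1) * ε := by positivity
      exact h0.trans_le hl'
    · rw [eq_bot_iff]
      refine rootSup_le.2 fun l hl x hx => ?_
      by_contra h0
      have h1 := hM (hev l x hx (fun h => h0 (by rw [h]; exact Submodule.zero_mem _)))
      have hl' : (K + 1) * ε ≤ l H₀ := hl
      rw [div_lt_iff₀ hε] at hK
      linarith
    · refine rootSup_le.2 fun l hl x hx => mem_rootSup (l := l) ?_ hx
      simp only [Set.mem_ofPred_eq, Nat.cast_add, Nat.cast_one] at hl ⊢
      linarith
    · intro k x hx y hy
      have hx' : x ∈ rootSup a {l | ε ≤ l H₀} := by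
        have hle : rootSup a {l | 0 < l H₀} ≤ rootSup a {l | ε ≤ l H₀} := by
          refine rootSup_le.2 fun l hl x hx => ?_
          rcases eq_or_ne x 0 with rfl | h0
          · exact Submodule.zero_mem _
          · exact mem_rootSup (l := l) (hε' _ (hev l x hx h0) hl) hx
        exact hle hx
      refine lie_mem_rootSup (fun l hl m hm => ?_) hx' hy
      simp only [Set.mem_ofPred_eq, LinearMap.add_apply, Nat.cast_add, Nat.cast_one] at hl hm ⊢
      linarith
    · intro k x hx y hy
      refine lie_mem_rootSup (S := {0}) (S' := {l | (k + 1) * ε ≤ l H₀}) (fun l hl m hm => ?_)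
        (mem_rootSup (Set.mem_singleton _) fun h => ?_) hy
      · rw [Set.mem_singleton_iff.1 hl, zero_add]
        exact hm
      · simp [ha2 _ h.2 x hx]

section OrthProj

variable {V : Type*} [AddCommGroup V] [Module ℝ V]

/-- `f` is the orthogonal projection onto `W` for the form `B`. -/
def IsOrthProj (B : V →ₗ[ℝ] V →ₗ[ℝ] ℝ) (W : Submodule ℝ V) (f : V →ₗ[ℝ] V) : Prop :=
  ∀ x, f x ∈ W ∧ ∀ y ∈ W, B (f x) y = B x y

theorem isOrthProj_familyProj {ι : Type*} [Fintype ι] {B : V →ₗ[ℝ] V →ₗ[ℝ] ℝ}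
    (hB : ∀ x y, B x y = B y x) {W : Submodule ℝ V} {b : ι → V} (hb : ∀ i, b i ∈ W)
    (hW : ∀ x ∈ W, x = ∑ i, B (b i) x • b i) : IsOrthProj B W (familyProj B b) := by
  refine fun x => ⟨?_, fun y hy => ?_⟩
  · rw [familyProj_apply]
    exact Submodule.sum_mem _ fun i _ => Submodule.smul_mem _ _ (hb i)
  · have h1 : B x y = ∑ i, B (b i) y * B x (b i) := by
      conv_lhs => rw [hW y hy]
      simp
    rw [h1, familyProj_apply]
    simp only [map_sum, map_smul, LinearMap.sum_apply, LinearMap.smul_apply, smul_eq_mul]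
    exact Finset.sum_congr rfl fun i _ => by rw [hB x, mul_comm]

theorem exists_isOrthProj [Module.Finite ℝ V] {B : V →ₗ[ℝ] V →ₗ[ℝ] ℝ}
    (hB : ∀ x y, B x y = B y x) (hpos : ∀ x, x ≠ 0 → 0 < B x x) (W : Submodule ℝ V) :
    ∃ f, IsOrthProj B W f := by
  obtain ⟨n, b, hb, -, hW⟩ := exists_orthonormal_family B hB hpos W
  exact ⟨_, isOrthProj_familyProj hB hb hW⟩

namespace IsOrthProj

variable {B : V →ₗ[ℝ] V →ₗ[ℝ] ℝ} {W W' : Submodule ℝ V} {f f' : V →ₗ[ℝ] V}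
  (hpos : ∀ x, x ≠ 0 → 0 < B x x)

theorem mem (h : IsOrthProj B W f) (x : V) : f x ∈ W := (h x).1

include hpos

theorem eq_of (h : IsOrthProj B W f) {x w : V} (hw : w ∈ W) (hx : ∀ y ∈ W, B w y = B x y) :
    f x = w := by
  rw [← sub_eq_zero]
  by_contra hne
  refine (hpos _ hne).ne' ?_
  rw [LinearMap.map_sub₂, (h x).2 _ (sub_mem (h x).1 hw), hx _ (sub_mem (h x).1 hw), sub_self]

theorem unique (h : IsOrthProj B W f) (h' : IsOrthProj B W f') : f = f' :=
  LinearMap.ext fun x => h.eq_of hpos (h' x).1 (h' x).2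

theorem apply_of_mem (h : IsOrthProj B W f) {x : V} (hx : x ∈ W) : f x = x :=
  h.eq_of hpos hx fun _ _ => rfl

theorem apply_of_orthogonal (h : IsOrthProj B W f) {x : V} (hx : ∀ y ∈ W, B x y = 0) : f x = 0 :=
  h.eq_of hpos W.zero_mem fun y hy => by simp [hx y hy]

omit hpos in
theorem sup (hB : ∀ x y, B x y = B y x) (h : IsOrthProj B W f) (h' : IsOrthProj B W' f')
    (ho : ∀ x ∈ W, ∀ y ∈ W', B x y = 0) : IsOrthProj B (W ⊔ W') (f' + f) := by
  refine fun x => ⟨?_, fun y hy => ?_⟩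
  · rw [LinearMap.add_apply, add_comm]
    exact Submodule.add_mem_sup (h x).1 (h' x).1
  · obtain ⟨u, hu, v, hv, rfl⟩ := Submodule.mem_sup.1 hy
    simp only [LinearMap.add_apply, map_add, (h x).2 u hu, (h' x).2 v hv,
      ho _ (h x).1 v hv, hB _ u, ho u hu _ (h' x).1]
    rw [hB u x]
    ring

end IsOrthProj

end OrthProj

namespace IwasawaDecomp

variable {θ : g ≃ₗ⁅ℝ⁆ g} {a n : Submodule ℝ g} {H : g} (D : IwasawaDecomp θ a n H)
include D

theorem form_zero_n {z : g} (hz : ⁅H, z⁆ = 0) {x : g} (hx : x ∈ n) : cartanForm θ z x = 0 := by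
  obtain ⟨y, -, rfl⟩ := D.surj x hx
  rw [← D.cartan.form_lie_neg (D.theta_neg _ D.mem), hz]
  simp

theorem form_theta_n {x y : g} (hx : x ∈ n) (hy : y ∈ n) : cartanForm θ (θ x) y = 0 := by
  rw [D.cartan.form_symm, cartanForm_apply, D.cartan.1, D.killing_n y hy x hx, neg_zero]

theorem form_a_n {x y : g} (hx : x ∈ a) (hy : y ∈ n) : cartanForm θ x y = 0 :=
  D.form_zero_n (D.lie_a_a _ D.mem _ hx) hy

theorem lie_a_n {x y : g} (hx : x ∈ a) (hy : y ∈ n) : ⁅x, y⁆ ∈ n :=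
  D.lie_zero_n x (D.lie_a_a _ D.mem _ hx) y hy

theorem eq_zero_of_mem_n {x : g} (hx : x ∈ n) (h : ⁅H, x⁆ = 0) : x = 0 :=
  D.cartan.eq_zero_of_form x (D.form_zero_n h hx)

theorem lie_n_zero {x z : g} (hx : x ∈ n) (hz : ⁅H, z⁆ = 0) : ⁅x, z⁆ ∈ n := by
  rw [← lie_skew]
  exact neg_mem (D.lie_zero_n z hz x hx)

theorem lie_theta {z : g} (hz : ⁅H, z⁆ = 0) : ⁅H, θ z⁆ = 0 := by
  have h : θ ⁅H, z⁆ = -⁅H, θ z⁆ := by rw [LieEquiv.map_lie, D.theta_neg _ D.mem, neg_lie]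
  rw [hz, map_zero] at h
  exact neg_eq_zero.1 h.symm

end IwasawaDecomp

/-- The Lie algebra involution as a linear endomorphism. -/
def thetaEnd (θ : g ≃ₗ⁅ℝ⁆ g) : Module.End ℝ g := (θ : g →ₗ[ℝ] g)

/-- The adjoint operator as a linear endomorphism. -/
def adEnd (x : g) : Module.End ℝ g := (LieAlgebra.ad ℝ g x : g →ₗ[ℝ] g)

theorem thetaEnd_apply (θ : g ≃ₗ⁅ℝ⁆ g) (x : g) : thetaEnd θ x = θ x := rfl

theorem adEnd_apply (x y : g) : adEnd x y = ⁅x, y⁆ := rfl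

theorem adEnd_theta {θ : g ≃ₗ⁅ℝ⁆ g} (hθ : IsCartanInvolution θ) (x : g) :
    adEnd (θ x) = thetaEnd θ * adEnd x * thetaEnd θ := by
  ext y
  simp only [Module.End.mul_apply, adEnd_apply, thetaEnd_apply]
  rw [LieEquiv.map_lie, hθ.1]

theorem thetaEnd_mul_self {θ : g ≃ₗ⁅ℝ⁆ g} (hθ : IsCartanInvolution θ) :
    thetaEnd θ * thetaEnd θ = 1 := by
  ext y
  simp [thetaEnd_apply, hθ.1]

theorem adEnd_lie (x y : g) : adEnd ⁅x, y⁆ = adEnd x * adEnd y - adEnd y * adEnd x := by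
  ext z
  simp [adEnd_apply]

theorem killingForm_eq_trace (x y : g) :
    killingForm ℝ g x y = LinearMap.trace ℝ g (adEnd x * adEnd y) :=
  LieModule.traceForm_apply_apply ℝ g g x y

section TraceFormula

/-- The quadratic expression `∑ B([bᵢ, bⱼ], X)² - 2 ∑ B([X, bᵢ], bⱼ)²`. -/
def ricciSum {ι : Type*} [Fintype ι] (B : g →ₗ[ℝ] g →ₗ[ℝ] ℝ) (b : ι → g) (X : g) : ℝ :=
  ∑ i, ∑ j, B ⁅b i, b j⁆ X ^ 2 - 2 * ∑ i, ∑ j, B ⁅X, b i⁆ (b j) ^ 2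

theorem form_familyProj {ι : Type*} [Fintype ι] {θ : g ≃ₗ⁅ℝ⁆ g} (hθ : IsCartanInvolution θ)
    (b : ι → g) (x : g) :
    cartanForm θ x (familyProj (cartanForm θ) b x) = ∑ j, cartanForm θ (b j) x ^ 2 := by
  rw [familyProj_apply, map_sum]
  refine Finset.sum_congr rfl fun j _ => ?_
  rw [map_smul, smul_eq_mul, hθ.form_symm x, sq]

theorem ricciSum_eq_trace [Module.Finite ℝ g] {ι : Type*} [Fintype ι] {θ : g ≃ₗ⁅ℝ⁆ g}
    (hθ : IsCartanInvolution θ) (b : ι → g) (X : g) {σ : Module.End ℝ g}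
    (hσ : σ = familyProj (cartanForm θ) b) :
    ricciSum (cartanForm θ) b X =
      -LinearMap.trace ℝ g (adEnd (θ X) * σ * adEnd X * (thetaEnd θ * σ * thetaEnd θ)) +
      2 * LinearMap.trace ℝ g (adEnd (θ X) * σ * adEnd X * σ) := by
  have e1 : LinearMap.trace ℝ g (adEnd (θ X) * σ * adEnd X * (thetaEnd θ * σ * thetaEnd θ)) =
      LinearMap.trace ℝ g ((thetaEnd θ * adEnd (θ X) * σ * adEnd X * thetaEnd θ) *
        familyProj (cartanForm θ) b) := by
    rw [← hσ, ← mul_assoc, LinearMap.trace_mul_comm]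
    simp only [mul_assoc]
  rw [e1, trace_comp_familyProj]
  conv_rhs => rw [hσ, trace_comp_familyProj, ← hσ]
  rw [ricciSum, sub_eq_add_neg, ← mul_neg, ← Finset.sum_neg_distrib, ← Finset.sum_neg_distrib]
  congr 1
  · refine Finset.sum_congr rfl fun i _ => ?_
    simp only [Module.End.mul_apply, adEnd_apply, thetaEnd_apply]
    rw [← cartanForm_map, hθ.1, hθ.form_symm, hθ.form_lie, hθ.1, neg_neg, hθ.form_symm,
      hσ, form_familyProj hθ]
    refine Finset.sum_congr rfl fun j _ => ?_
    rw [hθ.form_lie, ← lie_skew, map_neg, neg_neg]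
  · congr 1
    refine Finset.sum_congr rfl fun i _ => ?_
    simp only [Module.End.mul_apply, adEnd_apply]
    rw [hθ.form_symm, hθ.form_lie, hθ.1, hθ.form_symm, hσ, form_familyProj hθ]
    congr 1
    refine Finset.sum_congr rfl fun j _ => ?_
    rw [hθ.form_symm]

namespace IwasawaDecomp

variable {θ : g ≃ₗ⁅ℝ⁆ g} {a n : Submodule ℝ g} {H : g} (D : IwasawaDecomp θ a n H)
  {P α : Module.End ℝ g} (hP : IsOrthProj (cartanForm θ) n P)
  (hα : IsOrthProj (cartanForm θ) a α)
include D

theorem end_ext {f f' : Module.End ℝ g} (h1 : ∀ u ∈ n, f u = f' u)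
    (h2 : ∀ z : g, ⁅H, z⁆ = 0 → f z = f' z) (h3 : ∀ v ∈ n, f (θ v) = f' (θ v)) : f = f' := by
  ext x
  obtain ⟨u, hu, z, hz, v, hv, rfl⟩ := D.decomp x
  simp only [map_add, h1 u hu, h2 z hz, h3 v hv]

include hP

theorem proj_n {u : g} (hu : u ∈ n) : P u = u := hP.apply_of_mem D.cartan.form_pos hu

theorem proj_zero {z : g} (hz : ⁅H, z⁆ = 0) : P z = 0 :=
  hP.apply_of_orthogonal D.cartan.form_pos fun _ hy => D.form_zero_n hz hy

theorem proj_theta {v : g} (hv : v ∈ n) : P (θ v) = 0 :=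
  hP.apply_of_orthogonal D.cartan.form_pos fun _ hy => D.form_theta_n hv hy

theorem ad_comp_proj {X : g} (hX : X ∈ n) : P * adEnd X * P = adEnd X * P := by
  ext x
  exact D.proj_n hP (D.lie_n_n _ hX _ (hP.mem x))

theorem ad_comp_projZero {X : g} (hX : X ∈ n) :
    P * adEnd X * (1 - P - thetaEnd θ * P * thetaEnd θ) =
      adEnd X * (1 - P - thetaEnd θ * P * thetaEnd θ) := by
  refine D.end_ext (fun u hu => ?_) (fun z hz => ?_) (fun v hv => ?_)
  · have : (1 - P - thetaEnd θ * P * thetaEnd θ) u = 0 := by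
      simp [thetaEnd_apply, D.proj_n hP hu, D.proj_theta hP hu]
    simp only [Module.End.mul_apply] at this ⊢
    simp only [this, map_zero]
  · have : (1 - P - thetaEnd θ * P * thetaEnd θ) z = z := by
      simp [thetaEnd_apply, D.proj_zero hP hz, D.proj_zero hP (D.lie_theta hz)]
    rw [Module.End.mul_apply, Module.End.mul_apply, Module.End.mul_apply, this]
    exact D.proj_n hP (D.lie_n_zero hX hz)
  · have : (1 - P - thetaEnd θ * P * thetaEnd θ) (θ v) = 0 := by
      simp [thetaEnd_apply, D.proj_n hP hv, D.proj_theta hP hv, D.cartan.1]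
    simp only [Module.End.mul_apply] at this ⊢
    simp only [this, map_zero]

theorem proj_comm_ad_H : P * adEnd H = adEnd H * P := by
  have hH := D.theta_neg _ D.mem
  refine D.end_ext (fun u hu => ?_) (fun z hz => ?_) (fun v hv => ?_)
  · simp [adEnd_apply, D.proj_n hP hu, D.proj_n hP (D.lie_a_n D.mem hu)]
  · simp [adEnd_apply, hz, D.proj_zero hP hz]
  · have e : ⁅H, θ v⁆ = -θ ⁅H, v⁆ := by
      rw [LieEquiv.map_lie, hH, neg_lie, neg_neg]
    simp [adEnd_apply, e, D.proj_theta hP hv, D.proj_theta hP (D.lie_a_n D.mem hv)]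

include hα

theorem proj_comp_ad_projA {X : g} (hX : X ∈ n) : P * adEnd X * α = adEnd X * α := by
  ext x
  exact D.proj_n hP (D.lie_n_zero hX (D.lie_a_a _ D.mem _ (hα.mem x)))

theorem projA_comp_ad_proj {X : g} (hX : X ∈ n) : α * adEnd X * P = 0 := by
  ext x
  exact hα.apply_of_orthogonal D.cartan.form_pos fun y hy => by
    rw [D.cartan.form_symm]
    exact D.form_a_n hy (D.lie_n_n _ hX _ (hP.mem x))

omit hP in
theorem projA_comp_ad_projA {X : g} (hX : X ∈ n) : α * adEnd X * α = 0 := by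
  ext x
  exact hα.apply_of_orthogonal D.cartan.form_pos fun y hy => by
    rw [D.cartan.form_symm]
    exact D.form_a_n hy (D.lie_n_zero hX (D.lie_a_a _ D.mem _ (hα.mem x)))

omit hP in
theorem theta_projA_theta : thetaEnd θ * α * thetaEnd θ = α := by
  ext x
  simp only [Module.End.mul_apply, thetaEnd_apply]
  rw [D.theta_neg _ (hα.mem _), ← map_neg]
  refine (hα.eq_of D.cartan.form_pos (hα.mem x) fun y hy => ?_)
  rw [(hα x).2 y hy, ← cartanForm_map, D.theta_neg y hy, map_neg, map_neg, LinearMap.neg_apply]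

theorem trace_identity [Module.Finite ℝ g] {X : g} (hX : X ∈ n) :
    -LinearMap.trace ℝ g (adEnd (θ X) * (P + α) * adEnd X *
        (thetaEnd θ * (P + α) * thetaEnd θ)) +
      2 * LinearMap.trace ℝ g (adEnd (θ X) * (P + α) * adEnd X * (P + α)) =
    -2 * LinearMap.trace ℝ g (P * adEnd ⁅X, θ X⁆) - cartanForm θ X X := by
  set τ := LinearMap.trace ℝ g with hτ
  set A := adEnd X with hA
  set Th := thetaEnd θ with hTh
  have hTT : Th * Th = 1 := thetaEnd_mul_self D.cartan
  have hA' : adEnd (θ X) = Th * A * Th := adEnd_theta D.cartan X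
  have h1 := D.ad_comp_proj hP hX
  have h2 := D.ad_comp_projZero hP hX
  have h3 := D.proj_comp_ad_projA hP hα hX
  have h4 := D.projA_comp_ad_proj hP hα hX
  have h5 := D.projA_comp_ad_projA hα hX
  have h6 := D.theta_projA_theta hα
  simp only [← hTh, ← hA] at h1 h2 h3 h4 h5 h6
  have hB : cartanForm θ X X = -τ (adEnd (θ X) * A) := by
    rw [cartanForm_apply, killingForm_symm, killingForm_eq_trace]
  rw [hB, adEnd_lie, ← hA]
  set A' := adEnd (θ X) with hA'def
  set P' := Th * P * Th with hP'
  have e0 : Th * (P + α) * Th = P' + α := by rw [mul_add, add_mul, h6]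
  rw [e0]
  have f1 : A' * (P + α) * A * (P + α) = A' * A * P + A' * A * α := by
    have : A' * (P + α) * A * (P + α) =
      A' * (P * A * P) + A' * (P * A * α) + A' * (α * A * P) + A' * (α * A * α) := by noncomm_ring
    rw [this, h1, h3, h4, h5]
    noncomm_ring
  have f2 : A' * (P + α) * A * (P' + α) = A' * P * A * P' + A' * α * A * P' + A' * A * α := by
    have : A' * (P + α) * A * (P' + α) = A' * P * A * P' + A' * α * A * P' +
      A' * (P * A * α) + A' * (α * A * α) := by noncomm_ring
    rw [this, h3, h5]
    noncomm_ring
  have f3 : τ (A' * α * A * P') = τ (A' * A * α) := by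
    have : A' * α * A * P' = (Th * A) * (Th * α) * (A * Th * P * Th) := by
      rw [hA', hP']
      noncomm_ring
    rw [this, ← LinearMap.trace_mul_comm]
    have : A * Th * P * Th * (Th * A * (Th * α)) = A * Th * (P * (Th * Th) * A * (Th * α)) := by
      noncomm_ring
    rw [this, hTT, LinearMap.trace_mul_comm]
    have e : Th * α = α * Th := by
      have : Th * α * (Th * Th) = α * Th := by rw [← mul_assoc, h6]
      rwa [hTT, mul_one] at this
    have : P * 1 * A * (Th * α) * (A * Th) = (P * A * α) * (Th * A * Th) := by
      rw [e]
      noncomm_ring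
    rw [this, h3, ← hA', LinearMap.trace_mul_comm, mul_assoc]
  have f4 : τ (A' * A * P') = τ (A' * P * A) := by
    have : A' * A * P' = (Th * A * Th * A * Th * P) * Th := by
      rw [hA', hP']
      noncomm_ring
    rw [this, LinearMap.trace_mul_comm]
    have : Th * (Th * A * Th * A * Th * P) = (Th * Th) * A * ((Th * A * Th) * P) := by
      noncomm_ring
    rw [this, hTT, one_mul, LinearMap.trace_mul_comm, ← hA']
  have f5 : τ (A' * A) = τ (A' * A * P) + τ (A' * A * (1 - P - P')) + τ (A' * A * P') := by
    rw [← map_add, ← map_add]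
    congr 1
    noncomm_ring
  have f6 : τ (A' * P * A) = τ (A' * A * P) + τ (A' * A * (1 - P - P')) + τ (A' * P * A * P') := by
    rw [mul_assoc A' A P, ← h1, mul_assoc A' A, ← h2, ← map_add, ← map_add]
    congr 1
    noncomm_ring
  have f7 : τ (P * (A * A' - A' * A)) = τ (A' * P * A) - τ (A' * A * P) := by
    rw [mul_sub, map_sub, LinearMap.trace_mul_comm _ P (A' * A), ← mul_assoc,
      LinearMap.trace_mul_comm _ (P * A), ← mul_assoc]
  rw [f1, f2, f7, map_add, map_add, map_add, f3]
  linarith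

end IwasawaDecomp

end TraceFormula

theorem trace_comp_eq_trace_subalgebra [Module.Finite ℝ g] {s : LieSubalgebra ℝ g}
    {σ : Module.End ℝ g} (hσ : ∀ x, σ x ∈ s) (hσ' : ∀ x ∈ s, σ x = x) (f : Module.End ℝ g)
    (f' : Module.End ℝ s) (h : ∀ x : s, (f' x : g) = f x) :
    LinearMap.trace ℝ g (f * σ) = LinearMap.trace ℝ s f' := by
  let π : g →ₗ[ℝ] s := LinearMap.codRestrict s.toSubmodule σ hσ
  let ι : s →ₗ[ℝ] g := s.toSubmodule.subtype
  have e1 : f * σ = (f ∘ₗ ι) ∘ₗ π := rfl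
  have e2 : π ∘ₗ (f ∘ₗ ι) = f' := by
    ext x
    change σ (f x) = f' x
    rw [← h, hσ' _ (f' x).2]
  rw [e1, LinearMap.trace_comp_comm', e2]

namespace IwasawaDecomp

variable {θ : g ≃ₗ⁅ℝ⁆ g} {a n : Submodule ℝ g} {H : g} (D : IwasawaDecomp θ a n H)
include D

/-- The element of `𝔞` dual to the functional `Y ↦ tr (P ∘ ad Y)`. -/
theorem exists_dual_trace [Module.Finite ℝ g] {P : Module.End ℝ g}
    (hP : IsOrthProj (cartanForm θ) n P) :
    ∃ R ∈ a, ∀ Y, killingForm ℝ g R Y = LinearMap.trace ℝ g (P * adEnd Y) := by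
  have hinj : Function.Injective (killingForm ℝ g) := by
    rw [injective_iff_map_eq_zero]
    intro x hx
    apply D.cartan.eq_zero_of_form
    rw [cartanForm_apply, hx, LinearMap.zero_apply, neg_zero]
  have hsurj : Function.Surjective (killingForm ℝ g) :=
    (LinearMap.injective_iff_surjective_of_finrank_eq_finrank
      (Subspace.dual_finrank_eq (K := ℝ) (V := g)).symm).1 hinj
  obtain ⟨R, hR⟩ := hsurj
    (LinearMap.trace ℝ g ∘ₗ LinearMap.mulLeft ℝ P ∘ₗ (LieAlgebra.ad ℝ g : g →ₗ[ℝ] Module.End ℝ g))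
  have hR' : ∀ Y, killingForm ℝ g R Y = LinearMap.trace ℝ g (P * adEnd Y) := fun Y => by
    rw [hR]
    rfl
  refine ⟨R, D.mem_a R ?_ ?_, hR'⟩
  · apply hinj
    ext Y
    have h1 : killingForm ℝ g ⁅H, R⁆ Y = -killingForm ℝ g R ⁅H, Y⁆ := killingForm_lie_left H R Y
    have h2 : LinearMap.trace ℝ g (P * (adEnd H * adEnd Y)) =
        LinearMap.trace ℝ g (P * (adEnd Y * adEnd H)) := by
      rw [← mul_assoc, D.proj_comm_ad_H hP, LinearMap.trace_mul_comm, ← mul_assoc,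
        LinearMap.trace_mul_comm]
    rw [h1, hR', adEnd_lie, mul_sub, map_sub, h2]
    simp
  · apply hinj
    ext Y
    have h1 : killingForm ℝ g (θ R) Y = killingForm ℝ g R (θ Y) := by
      rw [← LieAlgebra.killingForm_of_equiv_apply θ, D.cartan.1]
    rw [h1, map_neg, LinearMap.neg_apply, hR', hR']
    obtain ⟨m, b, hb, -, hW⟩ :=
      exists_orthonormal_family (cartanForm θ) D.cartan.form_symm D.cartan.form_pos n
    rw [hP.unique D.cartan.form_pos (isOrthProj_familyProj D.cartan.form_symm hb hW),
      LinearMap.trace_mul_comm, trace_comp_familyProj, LinearMap.trace_mul_comm,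
      trace_comp_familyProj, ← Finset.sum_neg_distrib]
    refine Finset.sum_congr rfl fun i _ => ?_
    rw [adEnd_apply, adEnd_apply, ← D.cartan.form_symm ⁅Y, b i⁆, D.cartan.form_lie, neg_neg]

theorem isOrthProj_add {P α : Module.End ℝ g} (hP : IsOrthProj (cartanForm θ) n P)
    (hα : IsOrthProj (cartanForm θ) a α) : IsOrthProj (cartanForm θ) (a ⊔ n) (P + α) :=
  hα.sup D.cartan.form_symm hP fun _ hx _ hy => D.form_a_n hx hy

theorem ricciSum_formula [Module.Finite ℝ g] {P : Module.End ℝ g}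
    (hP : IsOrthProj (cartanForm θ) n P) {R : g}
    (hR : ∀ Y, killingForm ℝ g R Y = LinearMap.trace ℝ g (P * adEnd Y))
    {ι : Type*} [Fintype ι] {b : ι → g} (hb : ∀ i, b i ∈ a ⊔ n)
    (hW : ∀ x ∈ a ⊔ n, x = ∑ i, cartanForm θ (b i) x • b i) {X : g} (hX : X ∈ n) :
    ricciSum (cartanForm θ) b X = 2 * cartanForm θ ⁅R, X⁆ X - cartanForm θ X X := by
  obtain ⟨α, hα⟩ := exists_isOrthProj D.cartan.form_symm D.cartan.form_pos a
  rw [ricciSum_eq_trace D.cartan b X ((D.isOrthProj_add hP hα).unique D.cartan.form_pos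
    (isOrthProj_familyProj D.cartan.form_symm hb hW)), D.trace_identity hP hα hX, ← hR,
    cartanForm_apply θ ⁅R, X⁆, ← lie_skew R X, map_neg, LinearMap.neg_apply, killingForm_lie_left]
  ring

theorem trace_ad_subalgebra [Module.Finite ℝ g] {P : Module.End ℝ g}
    (hP : IsOrthProj (cartanForm θ) n P) {s : LieSubalgebra ℝ g} (hs : s.toSubmodule = a ⊔ n)
    {x : s} (hx : (x : g) ∈ a) :
    LinearMap.trace ℝ s (LieAlgebra.ad ℝ s x) = LinearMap.trace ℝ g (P * adEnd (x : g)) := by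
  obtain ⟨α, hα⟩ := exists_isOrthProj D.cartan.form_symm D.cartan.form_pos a
  have hσ := D.isOrthProj_add hP hα
  rw [← hs] at hσ
  rw [← trace_comp_eq_trace_subalgebra (fun y => hσ.mem y)
    (fun y hy => hσ.apply_of_mem D.cartan.form_pos hy) (adEnd (x : g)) _ fun y => rfl, mul_add]
  have : adEnd (x : g) * α = 0 := by
    ext y
    exact D.lie_a_a _ hx _ (hα.mem y)
  rw [this, add_zero, LinearMap.trace_mul_comm]

theorem killingForm_a_eq [Module.Finite ℝ g] {s : LieSubalgebra ℝ g} (hs : s.toSubmodule = a ⊔ n)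
    {x y : s} (hx : (x : g) ∈ a) (hy : (y : g) ∈ a) :
    killingForm ℝ g (x : g) y =
      2 * LinearMap.trace ℝ s (LieAlgebra.ad ℝ s x ∘ₗ LieAlgebra.ad ℝ s y) := by
  obtain ⟨P, hP⟩ := exists_isOrthProj D.cartan.form_symm D.cartan.form_pos n
  obtain ⟨α, hα⟩ := exists_isOrthProj D.cartan.form_symm D.cartan.form_pos a
  have hσ := D.isOrthProj_add hP hα
  rw [← hs] at hσ
  rw [← trace_comp_eq_trace_subalgebra (fun y => hσ.mem y)
    (fun y hy => hσ.apply_of_mem D.cartan.form_pos hy) (adEnd (x : g) * adEnd (y : g)) _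
      fun y => rfl, mul_add]
  have h0 : adEnd (x : g) * adEnd (y : g) * α = 0 := by
    ext z
    have := D.lie_a_a _ hy _ (hα.mem z)
    simp [adEnd_apply, this]
  have h1 : adEnd (x : g) * adEnd (y : g) = adEnd (x : g) * adEnd (y : g) * P +
      adEnd (x : g) * adEnd (y : g) * (thetaEnd θ * P * thetaEnd θ) := by
    refine D.end_ext (fun u hu => ?_) (fun z hz => ?_) (fun v hv => ?_)
    · simp [thetaEnd_apply, D.proj_n hP hu, D.proj_theta hP hu]
    · have := D.lie_a_zero z hz _ hy
      simp [adEnd_apply, thetaEnd_apply, D.proj_zero hP hz, D.proj_zero hP (D.lie_theta hz), this]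
    · simp [thetaEnd_apply, D.proj_n hP hv, D.proj_theta hP hv, D.cartan.1]
  have h2 : ∀ w ∈ a, thetaEnd θ * adEnd w * thetaEnd θ = -adEnd w := fun w hw => by
    rw [← adEnd_theta D.cartan, D.theta_neg w hw]
    ext z
    simp [adEnd_apply]
  have hTT : thetaEnd θ * thetaEnd θ = 1 := thetaEnd_mul_self D.cartan
  have h3 : LinearMap.trace ℝ g (adEnd (x : g) * adEnd (y : g) * (thetaEnd θ * P * thetaEnd θ)) =
      LinearMap.trace ℝ g (adEnd (x : g) * adEnd (y : g) * P) := by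
    rw [← mul_assoc, LinearMap.trace_mul_comm]
    congr 1
    calc _ = thetaEnd θ * adEnd (x : g) * 1 * adEnd (y : g) * thetaEnd θ * P := by noncomm_ring
      _ = (thetaEnd θ * adEnd (x : g) * thetaEnd θ) * (thetaEnd θ * adEnd (y : g) * thetaEnd θ)
          * P := by
        rw [← hTT]
        noncomm_ring
      _ = _ := by
        rw [h2 _ hx, h2 _ hy]
        noncomm_ring
  rw [killingForm_eq_trace, h0, add_zero, two_mul]
  conv_lhs => rw [h1, map_add, h3]

end IwasawaDecomp

section Conjugation

/-- The exponential of a nilpotent inner derivation, up to second order. -/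
theorem exists_lieEquiv_of_nilpotent_ad {L : Type*} [LieRing L] [LieAlgebra ℝ L] (Y : L)
    (hY : IsNilpotent (LieAlgebra.ad ℝ L Y : Module.End ℝ L)) :
    ∃ e : L ≃ₗ⁅ℝ⁆ L, ∀ (T : L) (W : Submodule ℝ L), ⁅Y, ⁅Y, T⁆⁆ ∈ W →
      (∀ w ∈ W, ⁅Y, w⁆ ∈ W) → e T - T - ⁅Y, T⁆ ∈ W := by
  let _ : Module ℚ L := Module.compHom L (algebraMap ℚ ℝ)
  let _ : LieAlgebra ℚ L :=
    { lie_smul := fun t x y => lie_smul (algebraMap ℚ ℝ t) x y }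
  have hsmul : ∀ (q : ℚ) (x : L), q • x = (q : ℝ) • x := fun q x => rfl
  let D : LieDerivation ℝ L L := LieDerivation.ad ℝ L Y
  have hD : D.toLinearMap = (LieAlgebra.ad ℝ L Y : L →ₗ[ℝ] L) := by
    ext x
    simp [D]
  have hnil : IsNilpotent D.toLinearMap := by rw [hD]; exact hY
  refine ⟨LieDerivation.exp D hnil, fun T W h1 h2 => ?_⟩
  obtain ⟨N, hN⟩ := id hnil
  have hN' : D.toLinearMap ^ (N + 2) = 0 := by rw [pow_add, hN, zero_mul]
  have hpow : ∀ i : ℕ, (D.toLinearMap ^ (i + 2)) T ∈ W := by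
    intro i
    induction i with
    | zero =>
      rw [zero_add, pow_two, hD]
      exact h1
    | succ i ih =>
      rw [add_right_comm, pow_succ', Module.End.mul_apply]
      have := h2 _ ih
      rw [hD] at this ⊢
      exact this
  rw [LieDerivation.exp_map_apply, IsNilpotent.exp_eq_sum hN', Finset.sum_range_succ',
    Finset.sum_range_succ', LinearMap.add_apply, LinearMap.add_apply, LinearMap.sum_apply]
  have e1 : (((0 + 1).factorial : ℚ)⁻¹ • D.toLinearMap ^ (0 + 1)) T = ⁅Y, T⁆ := by
    simp [hD]
  have e2 : ((Nat.factorial 0 : ℚ)⁻¹ • D.toLinearMap ^ 0) T = T := by simp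
  rw [e1, e2, add_sub_cancel_right, add_sub_cancel_right]
  refine Submodule.sum_mem _ fun i _ => ?_
  rw [LinearMap.smul_apply, hsmul]
  exact W.smul_mem _ (hpow i)

namespace IwasawaDecomp

variable {θ : g ≃ₗ⁅ℝ⁆ g} {a n : Submodule ℝ g} {H : g} (D : IwasawaDecomp θ a n H)
  {s : LieSubalgebra ℝ g} (hs : s.toSubmodule = a ⊔ n)

include hs in
omit D in
theorem mem_of_mem_a {x : g} (hx : x ∈ a) : x ∈ s := by
  rw [← LieSubalgebra.mem_toSubmodule, hs]
  exact Submodule.mem_sup_left hx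

include hs in
omit D in
theorem mem_of_mem_n {x : g} (hx : x ∈ n) : x ∈ s := by
  rw [← LieSubalgebra.mem_toSubmodule, hs]
  exact Submodule.mem_sup_right hx

include hs in
omit D in
theorem exists_add (x : s) : ∃ u ∈ a, ∃ v ∈ n, u + v = (x : g) := by
  have := x.2
  rw [← LieSubalgebra.mem_toSubmodule, hs] at this
  exact Submodule.mem_sup.1 this

include D hs

theorem lie_mem_n (x y : s) : (⁅x, y⁆ : s).1 ∈ n := by
  obtain ⟨u, hu, v, hv, hx⟩ := exists_add hs x
  obtain ⟨u', hu', v', hv', hy⟩ := exists_add hs y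
  rw [LieSubalgebra.coe_bracket, ← hx, ← hy]
  rw [add_lie, lie_add, lie_add, D.lie_a_a u hu u' hu', zero_add]
  refine add_mem (D.lie_a_n hu hv') (add_mem ?_ (D.lie_n_n _ hv _ hv'))
  rw [← lie_skew]
  exact neg_mem (D.lie_a_n hu' hv)

theorem lieEquiv_mem_n {g' : Type*} [LieRing g'] [LieAlgebra ℝ g'] {θ' : g' ≃ₗ⁅ℝ⁆ g'}
    {a' n' : Submodule ℝ g'} {H' : g'} (D' : IwasawaDecomp θ' a' n' H') {s' : LieSubalgebra ℝ g'}
    (hs' : s'.toSubmodule = a' ⊔ n') (e : s ≃ₗ⁅ℝ⁆ s') {x : s} (hx : (x : g) ∈ n) :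
    (e x : g') ∈ n' := by
  obtain ⟨y, hy, hxy⟩ := D.surj _ hx
  have : x = ⁅(⟨H, mem_of_mem_a hs D.mem⟩ : s), (⟨y, mem_of_mem_n hs hy⟩ : s)⁆ := Subtype.ext hxy
  rw [this, LieEquiv.map_lie]
  exact D'.lie_mem_n hs' _ _

/-- An element of `𝔰` acting injectively on `𝔫` is conjugate to an element of `𝔞`. -/
theorem exists_lieEquiv_mem_a [Module.Finite ℝ g] (T : s)
    (hT : ∀ x : s, (x : g) ∈ n → ⁅T, x⁆ = 0 → x = 0) :
    ∃ σ : s ≃ₗ⁅ℝ⁆ s, (σ T : g) ∈ a := by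
  obtain ⟨F, K, hF0, hFn, hFK, hF3, hF1, hF2⟩ := D.filtration
  suffices h : ∀ k, ∃ σ : s ≃ₗ⁅ℝ⁆ s, ∃ h ∈ a, (σ T : g) - h ∈ F k by
    obtain ⟨σ, h, hh, h0⟩ := h K
    rw [hFK, Submodule.mem_bot, sub_eq_zero] at h0
    exact ⟨σ, by rwa [h0]⟩
  intro k
  induction k with
  | zero =>
    obtain ⟨u, hu, v, hv, hx⟩ := exists_add hs T
    refine ⟨LieEquiv.refl, u, hu, ?_⟩
    rw [hF0, LieEquiv.refl_apply, ← hx, add_sub_cancel_left]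
    exact hv
  | succ k ih =>
    obtain ⟨σ, h, hh, hk⟩ := ih
    obtain ⟨m, hm⟩ : ∃ m, m = (σ T : g) - h := ⟨_, rfl⟩
    rw [← hm] at hk
    have hσT : (σ T : g) = h + m := by rw [hm, add_sub_cancel]
    have hmaps : ∀ x ∈ F k, adEnd (σ T : g) x ∈ F k := fun x hx => by
      rw [adEnd_apply, hσT, add_lie]
      exact add_mem (hF2 k h hh x hx) (hF3 k (hF1 k m (hFn k hk) x hx))
    have hinj : Function.Injective ((adEnd (σ T : g)).restrict hmaps) := by
      rw [injective_iff_map_eq_zero]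
      intro x hx
      have hxn := hFn k x.2
      let x' : s := ⟨x, mem_of_mem_n hs hxn⟩
      have h1 : ⁅σ T, x'⁆ = 0 := by
        have h0 : ⁅(σ T : g), (x : g)⁆ = 0 := congrArg Subtype.val hx
        exact Subtype.ext h0
      have h2 : ⁅T, σ.symm x'⁆ = 0 := by
        rw [← σ.symm_apply_apply T, ← LieEquiv.map_lie, h1, map_zero]
      have h3 := hT _ (D.lieEquiv_mem_n hs D hs σ.symm (x := x') hxn) h2
      have h4 : x' = 0 := by rw [← σ.apply_symm_apply x', h3, map_zero]
      have h5 : (x : g) = 0 := congrArg Subtype.val h4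
      exact Subtype.ext h5
    obtain ⟨Y, hY⟩ := LinearMap.injective_iff_surjective.1 hinj ⟨m, hk⟩
    have hYm : ⁅(σ T : g), (Y : g)⁆ = m := congrArg Subtype.val hY
    have hYn := hFn k Y.2
    let Y' : s := ⟨Y, mem_of_mem_n hs hYn⟩
    have hnil : ∀ (i : ℕ) (x : s),
        (((LieAlgebra.ad ℝ s Y' : Module.End ℝ s) ^ (i + 1)) x : g) ∈ F i := by
      intro i x
      induction i with
      | zero =>
        rw [hF0, zero_add, pow_one]
        exact D.lie_mem_n hs Y' x
      | succ i ih =>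
        rw [pow_succ', Module.End.mul_apply]
        exact hF1 i Y hYn _ ih
    obtain ⟨e, he⟩ := exists_lieEquiv_of_nilpotent_ad Y' ⟨K + 1, by
      ext x
      have := hnil K x
      rw [hFK, Submodule.mem_bot] at this
      rw [this]
      rfl⟩
    refine ⟨σ.trans e, h, hh, ?_⟩
    have h1 : (⁅Y', σ T⁆ : s).1 = -m := by
      rw [← hYm, lie_skew]
      rfl
    have h2 := he (σ T) ((F (k + 1)).comap s.toSubmodule.subtype)
      (by
        change (⁅Y', ⁅Y', σ T⁆⁆ : s).1 ∈ F (k + 1)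
        rw [LieSubalgebra.coe_bracket, h1, lie_neg]
        exact neg_mem (hF1 k Y hYn m hk))
      (fun w hw => hF3 _ (hF1 _ Y hYn _ hw))
    have h3 : (e (σ T) : g) - σ T - (⁅Y', σ T⁆ : s).1 ∈ F (k + 1) := h2
    rw [h1, hσT] at h3
    rw [LieEquiv.trans_apply]
    convert h3 using 1
    abel

end IwasawaDecomp

end Conjugation

section Isometric

variable {g₁ g₂ : Type*} [LieRing g₁] [LieAlgebra ℝ g₁] [LieRing g₂] [LieAlgebra ℝ g₂]
  {θ₁ : g₁ ≃ₗ⁅ℝ⁆ g₁} {a₁ n₁ : Submodule ℝ g₁} {H₁ : g₁}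
  {θ₂ : g₂ ≃ₗ⁅ℝ⁆ g₂} {a₂ n₂ : Submodule ℝ g₂} {H₂ : g₂}
  {s₁ : LieSubalgebra ℝ g₁} {s₂ : LieSubalgebra ℝ g₂}

namespace IwasawaDecomp

variable (D₁ : IwasawaDecomp θ₁ a₁ n₁ H₁) (D₂ : IwasawaDecomp θ₂ a₂ n₂ H₂)
  (hs₁ : s₁.toSubmodule = a₁ ⊔ n₁) (hs₂ : s₂.toSubmodule = a₂ ⊔ n₂)
include D₁ D₂ hs₁ hs₂

/-- Isomorphic Iwasawa subalgebras are isomorphic compatibly with the splittings `𝔞 ⊕ 𝔫`. -/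
theorem exists_adapted_lieEquiv [Module.Finite ℝ g₂] (φ : s₁ ≃ₗ⁅ℝ⁆ s₂) :
    ∃ ψ : s₁ ≃ₗ⁅ℝ⁆ s₂, (∀ x : s₁, (x : g₁) ∈ a₁ → (ψ x : g₂) ∈ a₂) ∧
      ∀ y : s₂, (y : g₂) ∈ a₂ → (ψ.symm y : g₁) ∈ a₁ := by
  let T : s₁ := ⟨H₁, mem_of_mem_a hs₁ D₁.mem⟩
  have hinj : ∀ e : s₁ ≃ₗ⁅ℝ⁆ s₂, ∀ x : s₂, (x : g₂) ∈ n₂ → ⁅e T, x⁆ = 0 → x = 0 := by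
    intro e x hx h
    have h1 : ⁅T, e.symm x⁆ = 0 := by
      rw [← e.symm_apply_apply T, ← LieEquiv.map_lie, h, map_zero]
    have h2 : (e.symm x : g₁) = 0 :=
      D₁.eq_zero_of_mem_n (D₂.lieEquiv_mem_n hs₂ D₁ hs₁ e.symm hx) (congrArg Subtype.val h1)
    have h3 : e.symm x = 0 := Subtype.ext h2
    rw [← e.apply_symm_apply x, h3, map_zero]
  obtain ⟨σ, hσ⟩ := D₂.exists_lieEquiv_mem_a hs₂ (φ T) (hinj φ)
  have hσ' : ((φ.trans σ) T : g₂) ∈ a₂ := hσ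
  have ha : ∀ x : s₁, (x : g₁) ∈ a₁ → ((φ.trans σ) x : g₂) ∈ a₂ := by
    intro x hx
    obtain ⟨u, hu, v, hv, huv⟩ := exists_add hs₂ ((φ.trans σ) x)
    have h1 : ⁅(φ.trans σ) T, (φ.trans σ) x⁆ = 0 := by
      have h0 : ⁅T, x⁆ = 0 := Subtype.ext (D₁.lie_a_a _ D₁.mem _ hx)
      rw [← LieEquiv.map_lie, h0, map_zero]
    have h2 : ⁅((φ.trans σ) T : g₂), v⁆ = 0 := by
      have h3 : ⁅((φ.trans σ) T : g₂), ((φ.trans σ) x : g₂)⁆ = 0 := congrArg Subtype.val h1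
      rwa [← huv, lie_add, D₂.lie_a_a _ hσ' _ hu, zero_add] at h3
    have h4 := hinj (φ.trans σ) ⟨v, mem_of_mem_n hs₂ hv⟩ hv (Subtype.ext h2)
    have h5 : v = 0 := congrArg Subtype.val h4
    rw [← huv, h5, add_zero]
    exact hu
  refine ⟨φ.trans σ, ha, fun y hy => ?_⟩
  set ψ := φ.trans σ
  obtain ⟨u, hu, v, hv, huv⟩ := exists_add hs₁ (ψ.symm y)
  let u' : s₁ := ⟨u, mem_of_mem_a hs₁ hu⟩
  let v' : s₁ := ⟨v, mem_of_mem_n hs₁ hv⟩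
  have h1 : ψ.symm y = u' + v' := Subtype.ext huv.symm
  have h2 : y = ψ u' + ψ v' := by rw [← map_add, ← h1, LieEquiv.apply_symm_apply]
  have h3 : (ψ v' : g₂) ∈ n₂ := D₁.lieEquiv_mem_n hs₁ D₂ hs₂ ψ hv
  have h4 : (ψ v' : g₂) ∈ a₂ := by
    have h5 : ψ v' = y - ψ u' := by rw [h2, add_sub_cancel_left]
    rw [h5]
    exact sub_mem hy (ha u' hu)
  have h6 : (ψ v' : g₂) = 0 := D₂.eq_zero_of_mem_n h3 (D₂.lie_a_a _ D₂.mem _ h4)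
  have h7 : ψ v' = 0 := Subtype.ext h6
  have h8 : v' = 0 := by rw [← ψ.symm_apply_apply v', h7, map_zero]
  rw [h1, h8, add_zero]
  exact hu

/-- Compatible isomorphisms of Iwasawa subalgebras preserve the Killing form on `𝔞`, and the
vectors dual to the trace functionals. -/
theorem killingForm_of_adapted [Module.Finite ℝ g₁] [Module.Finite ℝ g₂] {ψ : s₁ ≃ₗ⁅ℝ⁆ s₂}
    (hψ : ∀ x : s₁, (x : g₁) ∈ a₁ → (ψ x : g₂) ∈ a₂) {x y : s₁} (hx : (x : g₁) ∈ a₁)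
    (hy : (y : g₁) ∈ a₁) :
    killingForm ℝ g₂ (ψ x : g₂) (ψ y) = killingForm ℝ g₁ (x : g₁) y := by
  rw [D₁.killingForm_a_eq hs₁ hx hy, D₂.killingForm_a_eq hs₂ (hψ x hx) (hψ y hy),
    ← LieAlgebra.conj_ad_apply, ← LieAlgebra.conj_ad_apply, ← LinearEquiv.conj_comp,
    LinearMap.trace_conj']

theorem dual_trace_of_adapted [Module.Finite ℝ g₁] [Module.Finite ℝ g₂] {ψ : s₁ ≃ₗ⁅ℝ⁆ s₂}
    (hψ : ∀ x : s₁, (x : g₁) ∈ a₁ → (ψ x : g₂) ∈ a₂)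
    (hψ' : ∀ y : s₂, (y : g₂) ∈ a₂ → (ψ.symm y : g₁) ∈ a₁)
    {P₁ : Module.End ℝ g₁} (hP₁ : IsOrthProj (cartanForm θ₁) n₁ P₁)
    {P₂ : Module.End ℝ g₂} (hP₂ : IsOrthProj (cartanForm θ₂) n₂ P₂)
    {R₁ : s₁} (hR₁a : (R₁ : g₁) ∈ a₁)
    (hR₁ : ∀ Y, killingForm ℝ g₁ R₁ Y = LinearMap.trace ℝ g₁ (P₁ * adEnd Y))
    {R₂ : g₂} (hR₂a : R₂ ∈ a₂)
    (hR₂ : ∀ Y, killingForm ℝ g₂ R₂ Y = LinearMap.trace ℝ g₂ (P₂ * adEnd Y)) :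
    (ψ R₁ : g₂) = R₂ := by
  have key : ∀ y : s₂, (y : g₂) ∈ a₂ →
      killingForm ℝ g₂ (ψ R₁ : g₂) y = killingForm ℝ g₂ R₂ y := by
    intro y hy
    have hx := hψ' y hy
    have e : ψ (ψ.symm y) = y := ψ.apply_symm_apply y
    conv_lhs => rw [← e]
    rw [D₁.killingForm_of_adapted D₂ hs₁ hs₂ hψ hR₁a hx, hR₁, hR₂,
      ← D₁.trace_ad_subalgebra hP₁ hs₁ hx, ← D₂.trace_ad_subalgebra hP₂ hs₂ hy]
    conv_rhs => rw [← e, ← LieAlgebra.conj_ad_apply, LinearMap.trace_conj']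
  have hmem : (ψ R₁ : g₂) - R₂ ∈ a₂ := sub_mem (hψ _ hR₁a) hR₂a
  rw [← sub_eq_zero]
  apply D₂.cartan.eq_zero_of_form
  rw [cartanForm_apply, D₂.theta_neg _ hmem, map_neg, neg_neg, LinearMap.map_sub₂,
    key ⟨_, mem_of_mem_a hs₂ hmem⟩ hmem, sub_self]

end IwasawaDecomp

end Isometric

section IsometricLieEquiv

variable {g₁ g₂ : Type*} [LieRing g₁] [LieAlgebra ℝ g₁] [LieRing g₂] [LieAlgebra ℝ g₂]
  {θ₁ : g₁ ≃ₗ⁅ℝ⁆ g₁} {a₁ n₁ : Submodule ℝ g₁} {H₁ : g₁}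
  {θ₂ : g₂ ≃ₗ⁅ℝ⁆ g₂} {a₂ n₂ : Submodule ℝ g₂} {H₂ : g₂}
  {s₁ : LieSubalgebra ℝ g₁} {s₂ : LieSubalgebra ℝ g₂}

/-- An orthonormal basis of a Lie algebra expands the bracket. -/
theorem eq_sum_of_orthonormal {V ι : Type*} [AddCommGroup V] [Module ℝ V] [Fintype ι]
    [DecidableEq ι] (B : V →ₗ[ℝ] V →ₗ[ℝ] ℝ) (b : Module.Basis ι ℝ V)
    (hb : ∀ i j, B (b i) (b j) = if i = j then 1 else 0) (x : V) :
    x = ∑ i, B (b i) x • b i := by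
  conv_lhs => rw [← b.sum_repr x]
  refine Finset.sum_congr rfl fun i _ => ?_
  have h : B (b i) (∑ j, b.repr x j • b j) = b.repr x i := by
    simp only [map_sum, map_smul, hb]
    simp
  rw [b.sum_repr] at h
  rw [h]

/-- A basis rescaling compatible with the structure constants is a Lie algebra isomorphism. -/
theorem exists_lieEquiv_of_rescaling {L L' ι : Type*} [LieRing L] [LieAlgebra ℝ L] [LieRing L']
    [LieAlgebra ℝ L'] [Fintype ι] [DecidableEq ι] (B : L →ₗ[ℝ] L →ₗ[ℝ] ℝ) (b : Module.Basis ι ℝ L)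
    (hb : ∀ i j, B (b i) (b j) = if i = j then 1 else 0) (φ : L ≃ₗ⁅ℝ⁆ L') (w : ι → ℝ)
    (hw : ∀ i, w i ≠ 0) (h : ∀ i j k, B (b k) ⁅b i, b j⁆ ≠ 0 → w k = w i * w j) :
    ∃ ψ : L ≃ₗ⁅ℝ⁆ L', ∀ i, ψ (b i) = w i • φ (b i) := by
  let b' : Module.Basis ι ℝ L' :=
    (b.map φ.toLinearEquiv).isUnitSMul (fun i => (hw i).isUnit)
  let f : L ≃ₗ[ℝ] L' := b.equiv b' (Equiv.refl ι)
  have hf : ∀ i, f (b i) = w i • φ (b i) := fun i => by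
    simp only [f, b', Module.Basis.equiv_apply, Equiv.refl_apply, Module.Basis.isUnitSMul_apply,
      Module.Basis.map_apply]
    rfl
  have hlie : (LieAlgebra.ad ℝ L : L →ₗ[ℝ] L →ₗ[ℝ] L).compr₂ (f : L →ₗ[ℝ] L') =
      (LieAlgebra.ad ℝ L' : L' →ₗ[ℝ] L' →ₗ[ℝ] L').compl₁₂ (f : L →ₗ[ℝ] L') (f : L →ₗ[ℝ] L') := by
    refine LinearMap.ext_basis b b fun i j => ?_
    change f ⁅b i, b j⁆ = ⁅f (b i), f (b j)⁆
    rw [hf, hf, smul_lie, lie_smul, ← LieEquiv.map_lie, eq_sum_of_orthonormal B b hb ⁅b i, b j⁆,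
      map_sum, map_sum, Finset.smul_sum, Finset.smul_sum]
    refine Finset.sum_congr rfl fun k _ => ?_
    rw [map_smul, map_smul, hf, smul_smul, smul_smul, smul_smul]
    by_cases h0 : B (b k) ⁅b i, b j⁆ = 0
    · simp [h0]
    · rw [h i j k h0]
      congr 1
      ring
  exact ⟨{ f with map_lie' := fun {x y} => LinearMap.congr_fun₂ hlie x y }, hf⟩

namespace IwasawaDecomp

variable (D₁ : IwasawaDecomp θ₁ a₁ n₁ H₁) (D₂ : IwasawaDecomp θ₂ a₂ n₂ H₂)
  (hs₁ : s₁.toSubmodule = a₁ ⊔ n₁) (hs₂ : s₂.toSubmodule = a₂ ⊔ n₂)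
include D₁ D₂ hs₁ hs₂

/-- Isomorphic Iwasawa subalgebras are isometrically isomorphic. -/
theorem exists_isometric_lieEquiv [Module.Finite ℝ g₁] [Module.Finite ℝ g₂] (φ₀ : s₁ ≃ₗ⁅ℝ⁆ s₂) :
    ∃ ψ : s₁ ≃ₗ⁅ℝ⁆ s₂, ∀ x y : s₁,
      cartanForm θ₂ (ψ x : g₂) (ψ y) = cartanForm θ₁ (x : g₁) y := by
  obtain ⟨φ, hφ, hφ'⟩ := D₁.exists_adapted_lieEquiv D₂ hs₁ hs₂ φ₀
  obtain ⟨P₁, hP₁⟩ := exists_isOrthProj D₁.cartan.form_symm D₁.cartan.form_pos n₁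
  obtain ⟨P₂, hP₂⟩ := exists_isOrthProj D₂.cartan.form_symm D₂.cartan.form_pos n₂
  obtain ⟨R₁, hR₁a, hR₁⟩ := D₁.exists_dual_trace hP₁
  obtain ⟨R₂, hR₂a, hR₂⟩ := D₂.exists_dual_trace hP₂
  let R : s₁ := ⟨R₁, mem_of_mem_a hs₁ hR₁a⟩
  have hR : (φ R : g₂) = R₂ :=
    D₁.dual_trace_of_adapted D₂ hs₁ hs₂ hφ hφ' hP₁ hP₂ (R₁ := R) hR₁a hR₁ hR₂a hR₂
  let B : s₁ →ₗ[ℝ] s₁ →ₗ[ℝ] ℝ :=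
    (cartanForm θ₁).compl₁₂ s₁.toSubmodule.subtype s₁.toSubmodule.subtype
  let f : s₁ →ₗ[ℝ] g₂ := s₂.toSubmodule.subtype ∘ₗ (φ : s₁ →ₗ[ℝ] s₂)
  let Q : s₁ →ₗ[ℝ] s₁ →ₗ[ℝ] ℝ := (cartanForm θ₂).compl₁₂ f f
  have hB : ∀ x y : s₁, B x y = cartanForm θ₁ (x : g₁) y := fun x y => rfl
  have hQ : ∀ x y : s₁, Q x y = cartanForm θ₂ (φ x : g₂) (φ y) := fun x y => rfl
  have hBsymm : ∀ x y, B x y = B y x := fun x y => D₁.cartan.form_symm _ _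
  have hQsymm : ∀ x y, Q x y = Q y x := fun x y => D₂.cartan.form_symm _ _
  obtain ⟨m, b, s, hb, hbs⟩ := exists_basis_orthonormal_diagonal B Q hBsymm
    (fun x hx => D₁.cartan.form_pos _ (fun h => hx (Subtype.ext h))) hQsymm
  have hs : ∀ i, 0 < s i := fun i => by
    have h1 : 0 < Q (b i) (b i) := by
      refine D₂.cartan.form_pos _ fun h => b.ne_zero i ?_
      have h2 : φ (b i) = 0 := Subtype.ext h
      rw [← φ.symm_apply_apply (b i), h2, map_zero]
    rwa [hbs, hb, if_pos rfl, mul_one] at h1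
  have hbn : ∀ i, s i ≠ 1 → (b i : g₁) ∈ n₁ := by
    intro i hi
    obtain ⟨u, hu, v, hv, huv⟩ := exists_add hs₁ (b i)
    let u' : s₁ := ⟨u, mem_of_mem_a hs₁ hu⟩
    let v' : s₁ := ⟨v, mem_of_mem_n hs₁ hv⟩
    have hbi : b i = u' + v' := Subtype.ext huv.symm
    have hv' : (φ v' : g₂) ∈ n₂ := D₁.lieEquiv_mem_n hs₁ D₂ hs₂ φ hv
    have h1 : B (b i) u' = B u' u' := by
      have : B v' u' = 0 := by rw [hBsymm]; exact D₁.form_a_n hu hv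
      rw [hbi, map_add, LinearMap.add_apply, this, add_zero]
    have h2 : Q (b i) u' = B u' u' := by
      have h3 : Q v' u' = 0 := by rw [hQsymm]; exact D₂.form_a_n (hφ u' hu) hv'
      have h4 : Q u' u' = B u' u' := by
        rw [hQ, hB, cartanForm_apply, cartanForm_apply, D₂.theta_neg _ (hφ u' hu),
          D₁.theta_neg _ hu, map_neg, map_neg, D₁.killingForm_of_adapted D₂ hs₁ hs₂ hφ hu hu]
      rw [hbi, map_add, LinearMap.add_apply, h3, add_zero, h4]
    have h5 : (s i - 1) * B u' u' = 0 := by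
      have := hbs i u'
      rw [h1, h2] at this
      linarith
    have h6 : u = 0 :=
      D₁.cartan.eq_zero_of_form u ((mul_eq_zero.1 h5).resolve_left (sub_ne_zero.2 hi))
    rw [← huv, h6, zero_add]
    exact hv
  let w : Fin m → ℝ := fun i => (√(s i))⁻¹
  have hw : ∀ i, w i ≠ 0 := fun i => inv_ne_zero (Real.sqrt_pos.2 (hs i)).ne'
  have hw2 : ∀ i, w i ^ 2 = (s i)⁻¹ := fun i => by
    simp only [w, inv_pow, Real.sq_sqrt (hs i).le]
  have hexp := eq_sum_of_orthonormal B b hb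
  have hexp₁ : ∀ x ∈ a₁ ⊔ n₁, x = ∑ i, cartanForm θ₁ (b i : g₁) x • (b i : g₁) := by
    intro x hx
    rw [← hs₁] at hx
    have := congrArg s₁.toSubmodule.subtype (hexp ⟨x, hx⟩)
    simpa [map_sum, hB] using this
  have hQB : ∀ i x, w i * Q (b i) x = (w i)⁻¹ * B (b i) x := fun i x => by
    have h0 := hs i
    have h1 := hw2 i
    have h2 := hw i
    have h3 : s i * w i ^ 2 = 1 := by rw [h1, mul_inv_cancel₀ h0.ne']
    rw [hbs]
    field_simp
    linear_combination (B (b i) x) * h3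
  have hexp₂ : ∀ x ∈ a₂ ⊔ n₂, x = ∑ i, cartanForm θ₂ (w i • (φ (b i) : g₂)) x •
      (w i • (φ (b i) : g₂)) := by
    intro x hx
    rw [← hs₂] at hx
    have h1 := congrArg f (hexp (φ.symm ⟨x, hx⟩))
    have h2 : f (φ.symm ⟨x, hx⟩) = x := congrArg Subtype.val (φ.apply_symm_apply ⟨x, hx⟩)
    rw [h2, map_sum] at h1
    refine h1.trans (Finset.sum_congr rfl fun i _ => ?_)
    have h3 := hQB i (φ.symm ⟨x, hx⟩)
    have h4 : Q (b i) (φ.symm ⟨x, hx⟩) = cartanForm θ₂ (φ (b i) : g₂) x := by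
      rw [hQ, LieEquiv.apply_symm_apply]
    rw [map_smul, map_smul, LinearMap.smul_apply, smul_eq_mul, ← h4, h3, smul_smul]
    congr 1
    field_simp [hw i]
  have hc : ∀ i j k, cartanForm θ₁ ⁅(b i : g₁), (b j : g₁)⁆ (b k : g₁) = B (b k) ⁅b i, b j⁆ :=
    fun i j k => D₁.cartan.form_symm _ _
  have hc₂ : ∀ i j k, cartanForm θ₂ ⁅w i • (φ (b i) : g₂), w j • (φ (b j) : g₂)⁆
      (w k • (φ (b k) : g₂)) = w i * w j * w k * (s k * B (b k) ⁅b i, b j⁆) := by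
    intro i j k
    have h1 : cartanForm θ₂ ⁅(φ (b i) : g₂), (φ (b j) : g₂)⁆ (φ (b k) : g₂) =
        s k * B (b k) ⁅b i, b j⁆ := by
      rw [← hbs, hQsymm, hQ, LieEquiv.map_lie]
      rfl
    rw [smul_lie, lie_smul, map_smul, map_smul, map_smul, LinearMap.smul_apply,
      LinearMap.smul_apply, h1, smul_eq_mul, smul_eq_mul, smul_eq_mul]
    ring
  have hc₂' : ∀ i j k, cartanForm θ₂ ⁅w i • (φ (b i) : g₂), w j • (φ (b j) : g₂)⁆
      (w k • (φ (b k) : g₂)) ^ 2 = B (b k) ⁅b i, b j⁆ ^ 2 * (s k / (s i * s j)) := by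
    intro i j k
    have hi := (hs i).ne'
    have hj := (hs j).ne'
    have hk := (hs k).ne'
    rw [hc₂, mul_pow, mul_pow, mul_pow, hw2, hw2, hw2]
    field_simp
  have hscale : ∀ i j k, B (b k) ⁅b i, b j⁆ ≠ 0 → s k = s i * s j := by
    refine scale_eq_mul_of_balanced (fun i j k => B (b k) ⁅b i, b j⁆) s hs
      (fun i j k => by rw [← lie_skew, map_neg]) fun i hi => ?_
    have hφi : (φ (b i) : g₂) ∈ n₂ := D₁.lieEquiv_mem_n hs₁ D₂ hs₂ φ (hbn i hi)
    have e₁ := D₁.ricciSum_formula hP₁ hR₁ (b := fun i => (b i : g₁))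
      (fun i => hs₁ ▸ (b i).2) hexp₁ (hbn i hi)
    have e₂ := D₂.ricciSum_formula hP₂ hR₂ (b := fun i => w i • (φ (b i) : g₂))
      (fun i => Submodule.smul_mem _ _ (hs₂ ▸ (φ (b i)).2)) hexp₂ (Submodule.smul_mem _ (w i) hφi)
    have hws : w i * w i * s i = 1 := by
      rw [← pow_two, hw2, inv_mul_cancel₀ (hs i).ne']
    have e₃ : cartanForm θ₂ (w i • (φ (b i) : g₂)) (w i • (φ (b i) : g₂)) =
        cartanForm θ₁ (b i : g₁) (b i) := by
      have h1 : cartanForm θ₂ (φ (b i) : g₂) (φ (b i) : g₂) = s i * B (b i) (b i) := (hbs i _)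
      rw [map_smul, map_smul, LinearMap.smul_apply, h1, smul_eq_mul, smul_eq_mul, ← hB]
      linear_combination B (b i) (b i) * hws
    have e₄ : cartanForm θ₂ ⁅R₂, w i • (φ (b i) : g₂)⁆ (w i • (φ (b i) : g₂)) =
        cartanForm θ₁ ⁅R₁, (b i : g₁)⁆ (b i) := by
      have h1 : cartanForm θ₂ ⁅R₂, (φ (b i) : g₂)⁆ (φ (b i) : g₂) = s i * B (b i) ⁅R, b i⁆ := by
        rw [← hbs, hQsymm, hQ, LieEquiv.map_lie, ← hR]
        rfl
      have h2 : cartanForm θ₁ ⁅R₁, (b i : g₁)⁆ (b i) = B (b i) ⁅R, b i⁆ :=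
        D₁.cartan.form_symm _ _
      rw [lie_smul, map_smul, map_smul, LinearMap.smul_apply, h1, h2, smul_eq_mul, smul_eq_mul]
      linear_combination B (b i) ⁅R, b i⁆ * hws
    rw [e₃, e₄, ← e₁] at e₂
    simp only [ricciSum, hc₂', hc] at e₂
    exact e₂.symm
  have hwmul : ∀ i j k, B (b k) ⁅b i, b j⁆ ≠ 0 → w k = w i * w j := fun i j k h => by
    simp only [w]
    rw [hscale i j k h, Real.sqrt_mul (hs i).le, mul_inv]
  obtain ⟨ψ, hψ⟩ := exists_lieEquiv_of_rescaling B b hb φ w hw hwmul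
  refine ⟨ψ, fun x y => ?_⟩
  let f' : s₁ →ₗ[ℝ] g₂ := s₂.toSubmodule.subtype ∘ₗ (ψ : s₁ →ₗ[ℝ] s₂)
  have hext : (cartanForm θ₂).compl₁₂ f' f' = B := by
    refine LinearMap.ext_basis b b fun i j => ?_
    have h1 : ∀ i, f' (b i) = w i • (φ (b i) : g₂) := fun i => congrArg Subtype.val (hψ i)
    have h2 : cartanForm θ₂ (φ (b i) : g₂) (φ (b j) : g₂) = s i * B (b i) (b j) := hbs i _
    rw [LinearMap.compl₁₂_apply, h1, h1, map_smul, map_smul, LinearMap.smul_apply, h2, hb,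
      smul_eq_mul, smul_eq_mul]
    split_ifs with hij
    · subst hij
      rw [mul_one, ← mul_assoc, ← pow_two, hw2, inv_mul_cancel₀ (hs i).ne']
    · simp
  exact LinearMap.congr_fun₂ hext x y

end IwasawaDecomp

end IsometricLieEquiv

section LieTriple

theorem theta_sub_theta {θ : g ≃ₗ⁅ℝ⁆ g} (hθ : IsCartanInvolution θ) (x : g) :
    θ (x - θ x) = -(x - θ x) := by
  rw [map_sub, hθ.1, neg_sub]

theorem theta_add_theta {θ : g ≃ₗ⁅ℝ⁆ g} (hθ : IsCartanInvolution θ) (x : g) :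
    θ (x + θ x) = x + θ x := by
  rw [map_add, hθ.1, add_comm]

theorem theta_lie_neg {θ : g ≃ₗ⁅ℝ⁆ g} {k p : g} (hk : θ k = k) (hp : θ p = -p) :
    θ ⁅k, p⁆ = -⁅k, p⁆ := by
  rw [LieEquiv.map_lie, hk, hp, lie_neg]

/-- Twice the `𝔭`-component of a bracket. -/
theorem lie_sub_theta_lie (θ : g ≃ₗ⁅ℝ⁆ g) (x y : g) :
    (2 : ℝ) • (⁅x, y⁆ - θ ⁅x, y⁆) = ⁅x + θ x, y - θ y⁆ - ⁅y + θ y, x - θ x⁆ := by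
  rw [LieEquiv.map_lie, ← lie_skew (y + θ y)]
  simp only [lie_add, lie_sub, add_lie, sub_lie]
  module

/-- Twice the `𝔨`-component of a bracket. -/
theorem lie_add_theta_lie (θ : g ≃ₗ⁅ℝ⁆ g) (x y : g) :
    (2 : ℝ) • (⁅x, y⁆ + θ ⁅x, y⁆) = ⁅x + θ x, y + θ y⁆ + ⁅x - θ x, y - θ y⁆ := by
  rw [LieEquiv.map_lie]
  simp only [lie_add, lie_sub, add_lie, sub_lie]
  module

theorem IsNoncompactType.eq_zero_of_lie {θ : g ≃ₗ⁅ℝ⁆ g} (hθ : IsCartanInvolution θ)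
    (hn : IsNoncompactType θ) {k : g} (hk : θ k = k)
    (h : ∀ p : g, θ p = -p → ⁅k, p⁆ = 0) : k = 0 := by
  let I : LieIdeal ℝ g :=
    { carrier := {z | θ z = z ∧ ∀ p : g, θ p = -p → ⁅z, p⁆ = 0}
      add_mem' := fun {x y} hx hy => ⟨by rw [map_add, hx.1, hy.1], fun p hp => by
        rw [add_lie, hx.2 p hp, hy.2 p hp, add_zero]⟩
      zero_mem' := ⟨map_zero θ, fun p _ => zero_lie p⟩
      smul_mem' := fun c x hx => ⟨by rw [map_smul, hx.1], fun p hp => by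
        rw [smul_lie, hx.2 p hp, smul_zero]⟩
      lie_mem := fun {x z} hz => by
        have h1 : ⁅x, z⁆ = ⁅θ x, z⁆ := by
          have := hz.2 _ (theta_sub_theta hθ x)
          rw [← lie_skew, neg_eq_zero, sub_lie, sub_eq_zero] at this
          exact this
        refine ⟨by rw [LieEquiv.map_lie, hz.1, h1], fun p hp => ?_⟩
        have h2 : (2 : ℝ) • ⁅x, z⁆ = ⁅x + θ x, z⁆ := by rw [add_lie, ← h1, two_smul]
        have h3 : (2 : ℝ) • ⁅⁅x, z⁆, p⁆ = 0 := by
          rw [← smul_lie, h2, lie_lie, hz.2 p hp, lie_zero,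
            hz.2 _ (theta_lie_neg (theta_add_theta hθ x) hp), sub_zero]
        exact (smul_eq_zero.1 h3).resolve_left two_ne_zero }
  have hI : I = ⊥ := hn I fun x hx => hx.1
  have hkI : k ∈ I := ⟨hk, h⟩
  rw [hI] at hkI
  exact (LieSubmodule.mem_bot k).1 hkI

/-- In noncompact type, `𝔭` generates the Lie algebra. -/
theorem IsNoncompactType.eq_top_of_le [Module.Finite ℝ g] {θ : g ≃ₗ⁅ℝ⁆ g}
    (hθ : IsCartanInvolution θ) (hn : IsNoncompactType θ) (M : LieSubalgebra ℝ g)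
    (hM : ∀ p : g, θ p = -p → p ∈ M) (x : g) : x ∈ M := by
  obtain ⟨f, hf⟩ := exists_isOrthProj hθ.form_symm hθ.form_pos M.toSubmodule
  set z := x - f x with hz
  have hzM : ∀ m ∈ M, cartanForm θ z m = 0 := fun m hm => by
    rw [hz, LinearMap.map_sub₂, (hf x).2 m hm, sub_self]
  have hzθ : θ z = z := by
    have h0 := hzM _ (hM _ (theta_sub_theta hθ z))
    have h1 : cartanForm θ (z - θ z) (z - θ z) = 0 := by
      have h2 : cartanForm θ (θ z) (z - θ z) = 0 := by
        rw [← cartanForm_map, hθ.1, theta_sub_theta hθ, map_neg, h0, neg_zero]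
      rw [LinearMap.map_sub₂, h0, h2, sub_zero]
    exact (sub_eq_zero.1 (hθ.eq_zero_of_form _ h1)).symm
  have hz0 : z = 0 := hn.eq_zero_of_lie hθ hzθ fun p hp => by
    have h1 := theta_lie_neg hzθ hp
    apply hθ.eq_zero_of_form
    rw [← neg_eq_zero, ← LinearMap.map_neg₂, lie_skew, hθ.form_lie_neg hp,
      hzM _ (M.lie_mem (hM p hp) (hM _ h1))]
  rw [hz, sub_eq_zero] at hz0
  rw [hz0]
  exact hf.mem x

variable {g₁ g₂ : Type*} [LieRing g₁] [LieAlgebra ℝ g₁] [LieRing g₂] [LieAlgebra ℝ g₂]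

/-- An isomorphism of the Lie triple systems `𝔭` extends to an isomorphism of Lie algebras of
noncompact type. -/
theorem exists_lieEquiv_of_lieTriple [Module.Finite ℝ g₁] [Module.Finite ℝ g₂]
    {θ₁ : g₁ ≃ₗ⁅ℝ⁆ g₁} {θ₂ : g₂ ≃ₗ⁅ℝ⁆ g₂}
    (hθ₁ : IsCartanInvolution θ₁) (hθ₂ : IsCartanInvolution θ₂)
    (hn₁ : IsNoncompactType θ₁) (hn₂ : IsNoncompactType θ₂) (Ψ : g₁ →ₗ[ℝ] g₂)
    (hΨ : ∀ p, θ₁ p = -p → θ₂ (Ψ p) = -Ψ p)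
    (hinj : ∀ p, θ₁ p = -p → Ψ p = 0 → p = 0)
    (hsurj : ∀ q, θ₂ q = -q → ∃ p, θ₁ p = -p ∧ Ψ p = q)
    (htriple : ∀ p q r : g₁, θ₁ p = -p → θ₁ q = -q → θ₁ r = -r →
      Ψ ⁅⁅p, q⁆, r⁆ = ⁅⁅Ψ p, Ψ q⁆, Ψ r⁆) : Nonempty (g₁ ≃ₗ⁅ℝ⁆ g₂) := by
  let Γ : LieSubalgebra ℝ (g₁ × g₂) :=
    { carrier := {x | x.2 - θ₂ x.2 = Ψ (x.1 - θ₁ x.1) ∧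
        ∀ p : g₁, θ₁ p = -p → ⁅x.2 + θ₂ x.2, Ψ p⁆ = Ψ ⁅x.1 + θ₁ x.1, p⁆}
      add_mem' := fun {x y} hx hy => by
        refine ⟨?_, fun p hp => ?_⟩
        · have := congrArg₂ (· + ·) hx.1 hy.1
          simp only [← map_add] at this
          simp only [Prod.fst_add, Prod.snd_add, map_add]
          rw [add_sub_add_comm, add_sub_add_comm, this]
        · simp only [Prod.fst_add, Prod.snd_add, map_add]
          rw [add_add_add_comm, add_add_add_comm x.1, add_lie (x.2 + _), add_lie (x.1 + _), map_add, hx.2 p hp,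
            hy.2 p hp]
      zero_mem' := by simp
      smul_mem' := fun c x hx => by
        refine ⟨?_, fun p hp => ?_⟩
        · simp only [Prod.smul_fst, Prod.smul_snd, map_smul]
          rw [← smul_sub, ← smul_sub, hx.1, map_smul]
        · simp only [Prod.smul_fst, Prod.smul_snd, map_smul]
          rw [← smul_add, ← smul_add, smul_lie, smul_lie, map_smul, hx.2 p hp]
      lie_mem' := fun {x y} hx hy => by
        refine ⟨?_, fun p hp => ?_⟩
        · refine smul_right_injective g₂ (two_ne_zero' ℝ) ?_
          change (2 : ℝ) • (⁅x.2, y.2⁆ - θ₂ ⁅x.2, y.2⁆) = (2 : ℝ) • Ψ (⁅x.1, y.1⁆ - θ₁ ⁅x.1, y.1⁆)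
          rw [← map_smul, lie_sub_theta_lie, lie_sub_theta_lie, hx.1, hy.1,
            hx.2 _ (theta_sub_theta hθ₁ _), hy.2 _ (theta_sub_theta hθ₁ _), ← map_sub]
        · refine smul_right_injective g₂ (two_ne_zero' ℝ) ?_
          change (2 : ℝ) • ⁅⁅x.2, y.2⁆ + θ₂ ⁅x.2, y.2⁆, Ψ p⁆ =
            (2 : ℝ) • Ψ ⁅⁅x.1, y.1⁆ + θ₁ ⁅x.1, y.1⁆, p⁆
          have hkx := theta_lie_neg (theta_add_theta hθ₁ x.1) hp
          have hky := theta_lie_neg (theta_add_theta hθ₁ y.1) hp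
          rw [← map_smul, ← smul_lie, ← smul_lie, lie_add_theta_lie, lie_add_theta_lie,
            add_lie ⁅_, _⁆, add_lie ⁅_, _⁆, map_add, htriple _ _ _ (theta_sub_theta hθ₁ _) (theta_sub_theta hθ₁ _) hp,
            hx.1, hy.1, lie_lie (x.2 + _) (y.2 + _), lie_lie (x.1 + _) (y.1 + _), Ψ.map_sub ⁅_, _⁆,
            hy.2 _ hp, hx.2 _ hp, hx.2 _ hky, hy.2 _ hkx] }
  have hpΓ : ∀ p, θ₁ p = -p → (p, Ψ p) ∈ Γ := fun p hp => by
    refine ⟨?_, fun q _ => ?_⟩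
    · change Ψ p - θ₂ (Ψ p) = Ψ (p - θ₁ p)
      rw [hΨ p hp, hp, sub_neg_eq_add, sub_neg_eq_add, map_add]
    · change ⁅Ψ p + θ₂ (Ψ p), Ψ q⁆ = Ψ ⁅p + θ₁ p, q⁆
      rw [hΨ p hp, hp, add_neg_cancel, add_neg_cancel, zero_lie, zero_lie, map_zero]
  let π₁ : Γ →ₗ⁅ℝ⁆ g₁ := (LieHom.fst ℝ g₁ g₂).comp Γ.incl
  let π₂ : Γ →ₗ⁅ℝ⁆ g₂ := (LieHom.snd ℝ g₁ g₂).comp Γ.incl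
  have h₁ : Function.Bijective π₁ := by
    constructor
    · refine (injective_iff_map_eq_zero π₁).2 ?_
      rintro ⟨⟨u, v⟩, huv, huv'⟩ h
      obtain rfl : u = 0 := h
      simp only [map_zero, sub_zero, add_zero, zero_lie] at huv huv'
      have h0 : v + θ₂ v = 0 := hn₂.eq_zero_of_lie hθ₂ (theta_add_theta hθ₂ v) fun q hq => by
        obtain ⟨p, hp, rfl⟩ := hsurj q hq
        exact huv' p hp
      have : v = 0 := by
        rw [← sub_eq_zero.1 huv, ← two_smul ℝ] at h0
        exact (smul_eq_zero.1 h0).resolve_left two_ne_zero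
      subst this
      rfl
    · intro x
      have := hn₁.eq_top_of_le hθ₁ π₁.range
        (fun p hp => (LieHom.mem_range _ _).2 ⟨⟨_, hpΓ p hp⟩, rfl⟩) x
      exact (LieHom.mem_range _ _).1 this
  have h₂ : Function.Bijective π₂ := by
    constructor
    · refine (injective_iff_map_eq_zero π₂).2 ?_
      rintro ⟨⟨u, v⟩, huv, huv'⟩ h
      obtain rfl : v = 0 := h
      simp only [map_zero, sub_zero, add_zero, zero_lie] at huv huv'
      have h1 : u - θ₁ u = 0 := hinj _ (theta_sub_theta hθ₁ u) huv.symm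
      have h0 : u + θ₁ u = 0 := hn₁.eq_zero_of_lie hθ₁ (theta_add_theta hθ₁ u) fun p hp =>
        hinj _ (theta_lie_neg (theta_add_theta hθ₁ u) hp) (huv' p hp).symm
      have : u = 0 := by
        rw [← sub_eq_zero.1 h1, ← two_smul ℝ] at h0
        exact (smul_eq_zero.1 h0).resolve_left two_ne_zero
      subst this
      rfl
    · intro x
      have := hn₂.eq_top_of_le hθ₂ π₂.range (fun q hq => by
        obtain ⟨p, hp, rfl⟩ := hsurj q hq
        exact (LieHom.mem_range _ _).2 ⟨⟨_, hpΓ p hp⟩, rfl⟩) x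
      exact (LieHom.mem_range _ _).1 this
  exact ⟨(LieEquiv.ofBijective π₁ h₁).symm.trans (LieEquiv.ofBijective π₂ h₂)⟩

end LieTriple

section Extension

namespace IwasawaDecomp

variable {θ : g ≃ₗ⁅ℝ⁆ g} {a n : Submodule ℝ g} {H : g} (D : IwasawaDecomp θ a n H)
include D

/-- The inner product of `𝔭`-components in terms of the Iwasawa components. -/
theorem form_sub_theta {u v u' v' : g} (hu : u ∈ a) (hv : v ∈ n) (hu' : u' ∈ a) (hv' : v' ∈ n) :
    cartanForm θ (u + v - θ (u + v)) (u' + v' - θ (u' + v')) =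
      2 * (cartanForm θ (u + v) (u' + v') + cartanForm θ u u') := by
  have h1 : cartanForm θ (θ (u + v)) (u' + v') = -cartanForm θ u u' := by
    have h2 : cartanForm θ (θ v) u' = 0 := by
      rw [← cartanForm_map, D.cartan.1, D.theta_neg _ hu', map_neg, D.cartan.form_symm,
        D.form_a_n hu' hv, neg_zero]
    rw [map_add θ, map_add, map_add, LinearMap.add_apply, LinearMap.add_apply, h2,
      D.form_theta_n hv hv', D.theta_neg _ hu, map_neg, LinearMap.neg_apply, LinearMap.neg_apply,
      D.form_a_n hu hv']
    ring
  have h3 : cartanForm θ (u + v) (θ (u' + v')) = cartanForm θ (θ (u + v)) (u' + v') := by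
    rw [← cartanForm_map, D.cartan.1]
  rw [LinearMap.map_sub₂, map_sub, map_sub, cartanForm_map, h3, h1]
  ring

variable {s : LieSubalgebra ℝ g} (hs : s.toSubmodule = a ⊔ n)
include hs

theorem eq_zero_of_theta_eq {x : s} (hx : (x : g) - θ x = 0) : x = 0 := by
  obtain ⟨u, hu, v, hv, huv⟩ := exists_add hs x
  have h := D.form_sub_theta hu hv hu hv
  rw [huv, hx, map_zero] at h
  have h1 : 0 ≤ cartanForm θ u u := by
    by_cases h0 : u = 0
    · simp [h0]
    · exact (D.cartan.form_pos u h0).le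
  by_contra hne
  have h2 := D.cartan.form_pos (x : g) fun h0 => hne (Subtype.ext h0)
  linarith

theorem exists_sub_theta {p : g} (hp : θ p = -p) : ∃ x : s, (x : g) - θ x = p := by
  obtain ⟨u, hu, z, hz, v, hv, rfl⟩ := D.decomp p
  have hz' : (z - θ z) ∈ a := D.mem_a _ (by rw [lie_sub, hz, D.lie_theta hz, sub_zero])
    (theta_sub_theta D.cartan z)
  have h1 : (2⁻¹ : ℝ) • (u - v) + (4⁻¹ : ℝ) • (z - θ z) ∈ s :=
    s.add_mem (s.smul_mem _ (mem_of_mem_n hs (sub_mem hu hv)))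
      (s.smul_mem _ (mem_of_mem_a hs hz'))
  refine ⟨⟨_, h1⟩, ?_⟩
  simp only [map_add, map_sub, map_smul, D.cartan.1] at hp ⊢
  have h2 : θ u = -(u + z + θ v) - θ z - v := by rw [← hp]; abel
  rw [h2]
  module

end IwasawaDecomp

variable {g₁ g₂ : Type*} [LieRing g₁] [LieAlgebra ℝ g₁] [LieRing g₂] [LieAlgebra ℝ g₂]
  {θ₁ : g₁ ≃ₗ⁅ℝ⁆ g₁} {a₁ n₁ : Submodule ℝ g₁} {H₁ : g₁}
  {θ₂ : g₂ ≃ₗ⁅ℝ⁆ g₂} {a₂ n₂ : Submodule ℝ g₂} {H₂ : g₂}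
  {s₁ : LieSubalgebra ℝ g₁} {s₂ : LieSubalgebra ℝ g₂}

/-- A trilinear expression symmetric in the first two and antisymmetric in the last two
arguments vanishes. -/
theorem eq_zero_of_symm_of_skew {V : Type*} (E : V → V → V → ℝ) (h : ∀ x y z, E x y z = E y x z)
    (h' : ∀ x y z, E x y z = -E x z y) (x y z : V) : E x y z = 0 := by
  linarith [h x y z, h' y x z, h y z x, h' z y x, h z x y, h' x z y]

namespace IwasawaDecomp

variable (D₁ : IwasawaDecomp θ₁ a₁ n₁ H₁) (D₂ : IwasawaDecomp θ₂ a₂ n₂ H₂)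
  (hs₁ : s₁.toSubmodule = a₁ ⊔ n₁) (hs₂ : s₂.toSubmodule = a₂ ⊔ n₂)
include D₁ D₂ hs₁ hs₂

theorem isometry_mem_a {ψ : s₁ ≃ₗ⁅ℝ⁆ s₂}
    (hψ : ∀ x y : s₁, cartanForm θ₂ (ψ x : g₂) (ψ y) = cartanForm θ₁ (x : g₁) y) {x : s₁}
    (hx : (x : g₁) ∈ a₁) : (ψ x : g₂) ∈ a₂ := by
  obtain ⟨u, hu, v, hv, huv⟩ := exists_add hs₂ (ψ x)
  let v' : s₂ := ⟨v, mem_of_mem_n hs₂ hv⟩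
  have h1 : cartanForm θ₂ (ψ x : g₂) v = 0 := by
    have h2 := hψ x (ψ.symm v')
    rw [LieEquiv.apply_symm_apply] at h2
    exact h2.trans (D₁.form_a_n hx (D₂.lieEquiv_mem_n hs₂ D₁ hs₁ ψ.symm (x := v') hv))
  rw [← huv, map_add, LinearMap.add_apply, D₂.form_a_n hu hv, zero_add] at h1
  rw [← huv, D₂.cartan.eq_zero_of_form v h1, add_zero]
  exact hu

theorem isometry_form_sub_theta {ψ : s₁ ≃ₗ⁅ℝ⁆ s₂}
    (hψ : ∀ x y : s₁, cartanForm θ₂ (ψ x : g₂) (ψ y) = cartanForm θ₁ (x : g₁) y) (x y : s₁) :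
    cartanForm θ₂ ((ψ x : g₂) - θ₂ (ψ x)) ((ψ y : g₂) - θ₂ (ψ y)) =
      cartanForm θ₁ ((x : g₁) - θ₁ x) ((y : g₁) - θ₁ y) := by
  obtain ⟨u, hu, v, hv, huv⟩ := exists_add hs₁ x
  obtain ⟨u', hu', v', hv', huv'⟩ := exists_add hs₁ y
  let u₁ : s₁ := ⟨u, mem_of_mem_a hs₁ hu⟩
  let v₁ : s₁ := ⟨v, mem_of_mem_n hs₁ hv⟩
  let u₂ : s₁ := ⟨u', mem_of_mem_a hs₁ hu'⟩
  let v₂ : s₁ := ⟨v', mem_of_mem_n hs₁ hv'⟩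
  have hx : x = u₁ + v₁ := Subtype.ext huv.symm
  have hy : y = u₂ + v₂ := Subtype.ext huv'.symm
  have hψx : (ψ x : g₂) = ψ u₁ + ψ v₁ := by
    rw [hx, map_add]
    rfl
  have hψy : (ψ y : g₂) = ψ u₂ + ψ v₂ := by
    rw [hy, map_add]
    rfl
  have hxy := hψ x y
  rw [hψx, hψy, ← huv, ← huv'] at hxy
  rw [hψx, hψy, ← huv, ← huv', D₁.form_sub_theta hu hv hu' hv',
    D₂.form_sub_theta (D₁.isometry_mem_a D₂ hs₁ hs₂ hψ (x := u₁) hu)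
      (D₁.lieEquiv_mem_n hs₁ D₂ hs₂ ψ (x := v₁) hv)
      (D₁.isometry_mem_a D₂ hs₁ hs₂ hψ (x := u₂) hu')
      (D₁.lieEquiv_mem_n hs₁ D₂ hs₂ ψ (x := v₂) hv'), hxy, hψ]

/-- The Koszul formula: an isometry of Iwasawa subalgebras intertwines the Levi-Civita
connections. -/
theorem isometry_koszul {ψ : s₁ ≃ₗ⁅ℝ⁆ s₂}
    (hψ : ∀ x y : s₁, cartanForm θ₂ (ψ x : g₂) (ψ y) = cartanForm θ₁ (x : g₁) y) (x y z : s₁) :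
    cartanForm θ₂ ⁅(ψ x : g₂) + θ₂ (ψ x), (ψ y : g₂) - θ₂ (ψ y)⁆ ((ψ z : g₂) - θ₂ (ψ z)) =
      cartanForm θ₁ ⁅(x : g₁) + θ₁ x, (y : g₁) - θ₁ y⁆ ((z : g₁) - θ₁ z) := by
  have hiso := D₁.isometry_form_sub_theta D₂ hs₁ hs₂ hψ
  rw [← sub_eq_zero]
  refine eq_zero_of_symm_of_skew (fun x y z : s₁ =>
    cartanForm θ₂ ⁅(ψ x : g₂) + θ₂ (ψ x), (ψ y : g₂) - θ₂ (ψ y)⁆ ((ψ z : g₂) - θ₂ (ψ z)) -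
      cartanForm θ₁ ⁅(x : g₁) + θ₁ x, (y : g₁) - θ₁ y⁆ ((z : g₁) - θ₁ z))
    (fun x y z => ?_) (fun x y z => ?_) x y z
  · have h1 := congrArg (fun t => cartanForm θ₁ t ((z : g₁) - θ₁ z))
      (lie_sub_theta_lie θ₁ (x : g₁) y)
    have h2 := congrArg (fun t => cartanForm θ₂ t ((ψ z : g₂) - θ₂ (ψ z)))
      (lie_sub_theta_lie θ₂ (ψ x : g₂) (ψ y))
    have h3 := hiso ⁅x, y⁆ z
    rw [LieEquiv.map_lie, LieSubalgebra.coe_bracket, LieSubalgebra.coe_bracket] at h3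
    simp only [LinearMap.map_smul₂, LinearMap.map_sub₂ _ ⁅_ + _, _⁆] at h1 h2
    rw [h3] at h2
    linear_combination h1 - h2
  · have h1 := D₁.cartan.form_lie ((x : g₁) + θ₁ x) ((y : g₁) - θ₁ y) ((z : g₁) - θ₁ z)
    have h2 := D₂.cartan.form_lie ((ψ x : g₂) + θ₂ (ψ x)) ((ψ y : g₂) - θ₂ (ψ y))
      ((ψ z : g₂) - θ₂ (ψ z))
    rw [theta_add_theta D₁.cartan, D₁.cartan.form_symm ((y : g₁) - θ₁ y)] at h1
    rw [theta_add_theta D₂.cartan, D₂.cartan.form_symm ((ψ y : g₂) - θ₂ (ψ y))] at h2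
    linear_combination h2 - h1

/-- Isometrically isomorphic Iwasawa subalgebras come from isomorphic Lie algebras. -/
theorem exists_lieEquiv_of_isometry [Module.Finite ℝ g₁] [Module.Finite ℝ g₂]
    (hn₁ : IsNoncompactType θ₁) (hn₂ : IsNoncompactType θ₂) (ψ : s₁ ≃ₗ⁅ℝ⁆ s₂)
    (hψ : ∀ x y : s₁, cartanForm θ₂ (ψ x : g₂) (ψ y) = cartanForm θ₁ (x : g₁) y) :
    Nonempty (g₁ ≃ₗ⁅ℝ⁆ g₂) := by
  let σ₁ : s₁ →ₗ[ℝ] g₁ :=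
    (LinearMap.id - (θ₁ : g₁ →ₗ[ℝ] g₁)) ∘ₗ s₁.toSubmodule.subtype
  let σ₂ : s₂ →ₗ[ℝ] g₂ :=
    (LinearMap.id - (θ₂ : g₂ →ₗ[ℝ] g₂)) ∘ₗ s₂.toSubmodule.subtype
  have hσ₁ : LinearMap.ker σ₁ = ⊥ :=
    LinearMap.ker_eq_bot'.2 fun x hx => D₁.eq_zero_of_theta_eq hs₁ hx
  obtain ⟨q, hq⟩ := σ₁.exists_leftInverse_of_injective hσ₁
  let Ψ : g₁ →ₗ[ℝ] g₂ := σ₂ ∘ₗ (ψ : s₁ →ₗ[ℝ] s₂) ∘ₗ q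
  have hΨσ : ∀ x : s₁, Ψ ((x : g₁) - θ₁ x) = (ψ x : g₂) - θ₂ (ψ x) := fun x =>
    congrArg (fun y => σ₂ (ψ y)) (LinearMap.congr_fun hq x)
  have hsurj₁ : ∀ p, θ₁ p = -p → ∃ x : s₁, (x : g₁) - θ₁ x = p :=
    fun p hp => D₁.exists_sub_theta hs₁ hp
  have hΨ : ∀ p, θ₁ p = -p → θ₂ (Ψ p) = -Ψ p := fun p hp => by
    obtain ⟨x, rfl⟩ := hsurj₁ p hp
    rw [hΨσ, theta_sub_theta D₂.cartan]
  have hsurj : ∀ q, θ₂ q = -q → ∃ p, θ₁ p = -p ∧ Ψ p = q := fun q hq => by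
    obtain ⟨y, rfl⟩ := D₂.exists_sub_theta hs₂ hq
    refine ⟨_, theta_sub_theta D₁.cartan (ψ.symm y : g₁), ?_⟩
    rw [hΨσ, LieEquiv.apply_symm_apply]
  have hiso : ∀ p p', θ₁ p = -p → θ₁ p' = -p' →
      cartanForm θ₂ (Ψ p) (Ψ p') = cartanForm θ₁ p p' := fun p p' hp hp' => by
    obtain ⟨x, rfl⟩ := hsurj₁ p hp
    obtain ⟨y, rfl⟩ := hsurj₁ p' hp'
    rw [hΨσ, hΨσ, D₁.isometry_form_sub_theta D₂ hs₁ hs₂ hψ]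
  have hinj : ∀ p, θ₁ p = -p → Ψ p = 0 → p = 0 := fun p hp h0 => by
    apply D₁.cartan.eq_zero_of_form
    rw [← hiso p p hp hp, h0, map_zero]
  have hk : ∀ (x : s₁) (p : g₁), θ₁ p = -p →
      ⁅(ψ x : g₂) + θ₂ (ψ x), Ψ p⁆ = Ψ ⁅(x : g₁) + θ₁ x, p⁆ := by
    intro x p hp
    have hl := theta_lie_neg (theta_add_theta D₁.cartan (x : g₁)) hp
    have hr := theta_lie_neg (theta_add_theta D₂.cartan (ψ x : g₂)) (hΨ p hp)
    obtain ⟨r, hr', hr''⟩ := hsurj (⁅(ψ x : g₂) + θ₂ (ψ x), Ψ p⁆ - Ψ ⁅(x : g₁) + θ₁ x, p⁆)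
      (by rw [map_sub, hr, hΨ _ hl]; abel)
    rw [← sub_eq_zero]
    apply D₂.cartan.eq_zero_of_form
    have h1 : cartanForm θ₂ ⁅(ψ x : g₂) + θ₂ (ψ x), Ψ p⁆ (Ψ r) =
        cartanForm θ₁ ⁅(x : g₁) + θ₁ x, p⁆ r := by
      obtain ⟨y, rfl⟩ := hsurj₁ p hp
      obtain ⟨z, rfl⟩ := hsurj₁ r hr'
      rw [hΨσ, hΨσ, D₁.isometry_koszul D₂ hs₁ hs₂ hψ]
    rw [← hr'']
    nth_rw 1 [hr'']
    rw [LinearMap.map_sub₂, h1, hiso _ _ hl hr', sub_self]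
  refine exists_lieEquiv_of_lieTriple D₁.cartan D₂.cartan hn₁ hn₂ Ψ hΨ hinj hsurj ?_
  intro p p' r hp hp' hr
  obtain ⟨x, rfl⟩ := hsurj₁ p hp
  obtain ⟨y, rfl⟩ := hsurj₁ p' hp'
  have hkx := theta_lie_neg (theta_add_theta D₁.cartan (x : g₁)) hr
  have hky := theta_lie_neg (theta_add_theta D₁.cartan (y : g₁)) hr
  have h1 := eq_sub_of_add_eq' (lie_add_theta_lie θ₁ (x : g₁) y).symm
  have h2 := eq_sub_of_add_eq' (lie_add_theta_lie θ₂ (ψ x : g₂) (ψ y)).symm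
  have h3 := hk ⁅x, y⁆ r hr
  rw [LieEquiv.map_lie, LieSubalgebra.coe_bracket, LieSubalgebra.coe_bracket] at h3
  rw [hΨσ, hΨσ, h1, h2, sub_lie ((2 : ℝ) • _), sub_lie ((2 : ℝ) • _), smul_lie, smul_lie, h3,
    lie_lie ((x : g₁) + _), lie_lie ((ψ x : g₂) + _), Ψ.map_sub ((2 : ℝ) • _), Ψ.map_smul,
    Ψ.map_sub ⁅_, _⁆, hk y r hr, hk x r hr, hk x _ hky, hk y _ hkx]

end IwasawaDecomp

end Extension

/-- **Semi-simple Lie algebras are determined by their Iwasawa subalgebras.**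
If two finite-dimensional real semisimple Lie algebras of non-compact type have isomorphic
Iwasawa subalgebras, then they are isomorphic. -/
theorem iwasawa_determines_semisimple
    {g₁ g₂ : Type*} [LieRing g₁] [LieAlgebra ℝ g₁] [LieRing g₂] [LieAlgebra ℝ g₂]
    [Module.Finite ℝ g₁] [Module.Finite ℝ g₂]
    [LieAlgebra.IsKilling ℝ g₁] [LieAlgebra.IsKilling ℝ g₂]
    (s₁ : LieSubalgebra ℝ g₁) (s₂ : LieSubalgebra ℝ g₂)
    (hs₁ : IsIwasawaSubalgebraNC s₁) (hs₂ : IsIwasawaSubalgebraNC s₂)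
    (h : Nonempty (s₁ ≃ₗ⁅ℝ⁆ s₂)) : Nonempty (g₁ ≃ₗ⁅ℝ⁆ g₂) := by
  obtain ⟨θ₁, a₁, H₁, hθ₁, ha₁, hH₁, hn₁, hs₁⟩ := hs₁
  obtain ⟨θ₂, a₂, H₂, hθ₂, ha₂, hH₂, hn₂, hs₂⟩ := hs₂
  obtain ⟨φ⟩ := h
  have D₁ := IwasawaDecomp.of_isMaxAbelianInP hθ₁ ha₁ hH₁
  have D₂ := IwasawaDecomp.of_isMaxAbelianInP hθ₂ ha₂ hH₂
  obtain ⟨ψ, hψ⟩ := D₁.exists_isometric_lieEquiv D₂ hs₁ hs₂ φ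
  exact D₁.exists_lieEquiv_of_isometry D₂ hs₁ hs₂ hn₁ hn₂ ψ hψ
end
end

section
/- Let 𝔤 be a finite-dimensional complex semisimple Lie algebra, 𝔥 a Cartan subalgebra, Δ⁺ a positive system of roots, and 𝔫 = ⊕_{α∈Δ⁺} 𝔤_α the nilradical of the associated Borel subalgebra. Then the image 𝔥̃ = {(ad_𝔤 H)|_𝔫 : H ∈ 𝔥} is an abelian Lie subalgebra of Der(𝔫) consisting of diagonalizable (semisimple) endomorphisms of 𝔫, and it is maximal among such: if 𝔩 is any abelian Lie subalgebra of Der(𝔫) consisting of semisimple endomorphisms with 𝔥̃ ⊆ 𝔩, then 𝔩 = 𝔥̃. -/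
noncomputable section

variable {g : Type*} [LieRing g] [LieAlgebra ℂ g]

/-- The root space of a linear functional `α` on the Cartan subalgebra `h`:
`𝔤_α = {x ∈ 𝔤 | [H, x] = α(H) • x for all H ∈ 𝔥}`. -/
def rootSpaceOf (h : LieSubalgebra ℂ g) (α : Module.Dual ℂ h) : Submodule ℂ g where
  carrier := {x | ∀ H : h, ⁅(H : g), x⁆ = α H • x}
  add_mem' := by
    intro x y hx hy H
    rw [lie_add, hx H, hy H, smul_add]
  zero_mem' := by intro H; simp
  smul_mem' := by
    intro c x hx H
    rw [lie_smul, hx H, smul_comm]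

/-- The set of roots of `𝔤` relative to the Cartan subalgebra `h`. -/
def rootsOf (h : LieSubalgebra ℂ g) : Set (Module.Dual ℂ h) :=
  {α | α ≠ 0 ∧ rootSpaceOf h α ≠ ⊥}

/-- `P` is a positive system of roots: `P` consists of roots, every root is exactly one of
positive or negative, and `P` is closed under addition. -/
def IsPositiveSystem (h : LieSubalgebra ℂ g) (P : Set (Module.Dual ℂ h)) : Prop :=
  P ⊆ rootsOf h ∧ (∀ α ∈ rootsOf h, α ∈ P ↔ -α ∉ P) ∧
    ∀ α ∈ P, ∀ β ∈ P, α + β ∈ rootsOf h → α + β ∈ P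

open LieAlgebra LieAlgebra.IsKilling LieModule

/-- If `α`, `β` are weights of a Killing Lie algebra with `α ≠ 0` and the root space of `α + β` is
nonzero, then the bracket of the root spaces of `α` and `β` is nonzero. -/
lemma LieAlgebra.IsKilling.exists_lie_ne_zero_of_rootSpace_add_ne_bot
    {K L : Type*} [Field K] [CharZero K] [LieRing L] [LieAlgebra K L]
    [IsKilling K L] [FiniteDimensional K L]
    {H : LieSubalgebra K L} [H.IsCartanSubalgebra] [IsTriangularizable K H L]
    (α β : Weight K H L) (hα : α.IsNonZero)
    (hαβ : rootSpace H ((α : H → K) + β) ≠ ⊥) :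
    ∃ x ∈ rootSpace H α, ∃ y ∈ rootSpace H β, ⁅x, y⁆ ≠ 0 := by
  obtain ⟨m, hm, m_ne0⟩ := (chainTop α β).exists_ne_zero
  obtain ⟨h, e, f, isSl2, he, hf⟩ := exists_isSl2Triple_of_weight_isNonZero hα
  obtain rfl := isSl2.h_eq_coroot hα he hf
  have prim : isSl2.HasPrimitiveVectorWith m (chainLength α β : K) :=
    have := lie_mem_genWeightSpace_of_mem_genWeightSpace he hm
    ⟨m_ne0, (chainLength_smul _ _ hm).symm, by rwa [genWeightSpace_add_chainTop _ _ hα] at this⟩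
  have hpos : 1 ≤ chainTopCoeff α β := by
    have := ((rootSpace_zsmul_add_ne_bot_iff α β hα 1).mp (by rwa [one_smul])).1
    exact_mod_cast this
  obtain ⟨p, hp⟩ := Nat.exists_eq_add_of_le' hpos
  have hple : p + 1 ≤ chainLength α β := hp ▸ chainTopCoeff_le_chainLength α β
  refine ⟨e, he, (toEnd K L L f ^ (p + 1)) m, ?_, ?_⟩
  · convert toEnd_pow_apply_mem hf hm (p + 1) using 2
    rw [coe_chainTop', hp, smul_neg, neg_add_cancel_left]
  · rw [prim.lie_e_pow_succ_toEnd_f]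
    refine smul_ne_zero (mul_ne_zero (Nat.cast_add_one_ne_zero p) ?_)
      (prim.pow_toEnd_f_ne_zero_of_eq_nat rfl (by lia))
    rw [sub_ne_zero]
    exact_mod_cast (by lia : chainLength α β ≠ p)

/-- On a direct sum of submodules there is a linear map acting on each summand by a prescribed
scalar. -/
lemma exists_linearMap_smul_of_iSupIndep {ι R M : Type*} [CommRing R] [AddCommGroup M]
    [Module R M] {p : ι → Submodule R M} (hp : iSupIndep p) (htop : iSup p = ⊤) (c : ι → R) :
    ∃ f : M →ₗ[R] M, ∀ i, ∀ x ∈ p i, f x = c i • x := by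
  classical
  have hint := (DirectSum.isInternal_submodule_iff_iSupIndep_and_iSup_eq_top p).mpr ⟨hp, htop⟩
  let E := LinearEquiv.ofBijective (DirectSum.coeLinearMap p) hint
  refine ⟨(DirectSum.toModule R ι M fun i ↦ c i • (p i).subtype) ∘ₗ E.symm.toLinearMap,
    fun i x hx ↦ ?_⟩
  have hE : E.symm x = DirectSum.lof R ι (fun i ↦ p i) i ⟨x, hx⟩ := by
    rw [LinearEquiv.symm_apply_eq]
    exact (DirectSum.coeLinearMap_lof p i ⟨x, hx⟩).symm
  simp [hE]

section RootSpaces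

lemma lie_mem_rootSpaceOf_add {h : LieSubalgebra ℂ g} {α β : Module.Dual ℂ h} {x y : g}
    (hx : x ∈ rootSpaceOf h α) (hy : y ∈ rootSpaceOf h β) : ⁅x, y⁆ ∈ rootSpaceOf h (α + β) := by
  intro H
  rw [leibniz_lie, hx H, hy H, smul_lie, lie_smul, LinearMap.add_apply, add_smul]

variable [Module.Finite ℂ g] [IsKilling ℂ g] (h : LieSubalgebra ℂ g) [h.IsCartanSubalgebra]

lemma rootSpaceOf_eq_rootSpace (α : Module.Dual ℂ h) :
    rootSpaceOf h α = (rootSpace h α).toSubmodule := by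
  ext x
  refine ⟨fun hx ↦ ?_, fun hx H ↦ lie_eq_smul_of_mem_rootSpace hx H⟩
  exact weightSpace_le_genWeightSpace g α ((mem_weightSpace _ x).mpr hx)

lemma iSupIndep_rootSpaceOf : iSupIndep (rootSpaceOf h) := by
  have := (LieSubmodule.iSupIndep_toSubmodule.mpr (iSupIndep_genWeightSpace ℂ h g)).comp
    (DFunLike.coe_injective (F := Module.Dual ℂ h))
  convert this using 1
  exact funext (rootSpaceOf_eq_rootSpace h)

lemma iSup_rootSpaceOf_eq_top : ⨆ α, rootSpaceOf h α = ⊤ := by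
  have := congrArg LieSubmodule.toSubmodule (iSup_genWeightSpace_eq_top' ℂ h g)
  rw [LieSubmodule.iSup_toSubmodule, LieSubmodule.top_toSubmodule] at this
  rw [eq_top_iff, ← this]
  refine iSup_le fun χ ↦ le_trans ?_ (le_iSup (rootSpaceOf h) χ.toLinear)
  exact (rootSpaceOf_eq_rootSpace h χ.toLinear).ge

lemma mem_of_mem_rootSpaceOf_zero {x : g} (hx : x ∈ rootSpaceOf h 0) : x ∈ h := by
  rw [rootSpaceOf_eq_rootSpace] at hx
  exact (rootSpace_zero_eq ℂ g h).le hx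

lemma mem_rootSpaceOf_zero {x : g} (hx : x ∈ h) : x ∈ rootSpaceOf h 0 := by
  rw [rootSpaceOf_eq_rootSpace]
  exact (rootSpace_zero_eq ℂ g h).ge hx

variable {h}

/-- The weight attached to a root. -/
def weightOfRoot {α : Module.Dual ℂ h} (hα : α ∈ rootsOf h) : Weight ℂ h g :=
  ⟨α, fun hb ↦ hα.2 ((rootSpaceOf_eq_rootSpace h α).trans (congrArg LieSubmodule.toSubmodule hb))⟩

lemma weightOfRoot_isNonZero {α : Module.Dual ℂ h} (hα : α ∈ rootsOf h) :
    (weightOfRoot hα).IsNonZero :=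
  fun h0 ↦ hα.1 (DFunLike.coe_injective h0)

lemma exists_lie_ne_zero_of_add_mem_rootsOf {α β : Module.Dual ℂ h} (hα : α ∈ rootsOf h)
    (hβ : β ∈ rootsOf h) (hαβ : α + β ∈ rootsOf h) :
    ∃ x ∈ rootSpaceOf h α, ∃ y ∈ rootSpaceOf h β, ⁅x, y⁆ ≠ 0 := by
  simp only [rootSpaceOf_eq_rootSpace]
  exact exists_lie_ne_zero_of_rootSpace_add_ne_bot (weightOfRoot hα) (weightOfRoot hβ)
    (weightOfRoot_isNonZero hα) ((weightOfRoot hαβ).genWeightSpace_ne_bot _)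

lemma neg_mem_rootsOf {α : Module.Dual ℂ h} (hα : α ∈ rootsOf h) : -α ∈ rootsOf h := by
  refine ⟨neg_ne_zero.mpr hα.1, fun hb ↦ (-weightOfRoot hα).genWeightSpace_ne_bot _ ?_⟩
  rw [rootSpaceOf_eq_rootSpace] at hb
  exact LieSubmodule.toSubmodule_injective hb

lemma exists_smul_eq_of_mapsTo_rootSpaceOf {α : Module.Dual ℂ h} (hα : α ∈ rootsOf h)
    (f : rootSpaceOf h α →ₗ[ℂ] rootSpaceOf h α) : ∃ c : ℂ, ∀ x, f x = c • x := by
  have h1 : Module.finrank ℂ (rootSpaceOf h α) = 1 := by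
    rw [rootSpaceOf_eq_rootSpace]
    exact finrank_rootSpace_eq_one (weightOfRoot hα) (weightOfRoot_isNonZero hα)
  obtain ⟨v, -, hv⟩ := finrank_eq_one_iff'.mp h1
  obtain ⟨c, hc⟩ := hv (f v)
  refine ⟨c, fun x ↦ ?_⟩
  obtain ⟨a, rfl⟩ := hv x
  rw [map_smul, ← hc, smul_comm]

/-- A function on weights which is additive along nonzero root sums is evaluation at an element of
the Cartan subalgebra. -/
lemma exists_mem_cartan_of_additive (c : Module.Dual ℂ h → ℂ) (hc0 : c 0 = 0)
    (hc : ∀ α β, rootSpaceOf h α ≠ ⊥ → rootSpaceOf h β ≠ ⊥ → rootSpaceOf h (α + β) ≠ ⊥ →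
      c (α + β) = c α + c β) :
    ∃ H ∈ h, ∀ α, ∀ x ∈ rootSpaceOf h α, ⁅H, x⁆ = c α • x := by
  obtain ⟨f, hf⟩ := exists_linearMap_smul_of_iSupIndep (iSupIndep_rootSpaceOf h)
    (iSup_rootSpaceOf_eq_top h) c
  have hleib (x y : g) : f ⁅x, y⁆ = ⁅x, f y⁆ - ⁅y, f x⁆ := by
    have hx : x ∈ ⨆ α, rootSpaceOf h α := iSup_rootSpaceOf_eq_top h ▸ Submodule.mem_top
    have hy : y ∈ ⨆ α, rootSpaceOf h α := iSup_rootSpaceOf_eq_top h ▸ Submodule.mem_top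
    induction hx using Submodule.iSup_induction' with
    | zero => simp
    | add a b _ _ ha hb => simp only [add_lie, map_add, lie_add, ha, hb]; abel
    | mem α x hx =>
      induction hy using Submodule.iSup_induction' with
      | zero => simp
      | add a b _ _ ha hb => simp only [add_lie, map_add, lie_add, ha, hb]; abel
      | mem β y hy =>
        have hxy := lie_mem_rootSpaceOf_add hx hy
        rw [hf _ x hx, hf _ y hy, hf _ _ hxy, lie_smul, lie_smul, ← lie_skew y x, smul_neg,
          sub_neg_eq_add, ← add_smul]
        by_cases h0 : ⁅x, y⁆ = 0
        · rw [h0, smul_zero, smul_zero]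
        have ne_bot {γ : Module.Dual ℂ h} {z : g} (hz : z ∈ rootSpaceOf h γ) (hz0 : z ≠ 0) :
            rootSpaceOf h γ ≠ ⊥ := fun hb ↦ hz0 (by simpa [hb] using hz)
        rw [hc α β (ne_bot hx (by rintro rfl; simp at h0)) (ne_bot hy (by rintro rfl; simp at h0))
          (ne_bot hxy h0), add_comm]
  obtain ⟨H, hH⟩ := LieDerivation.IsKilling.exists_eq_ad (LieDerivation.mk f hleib)
  have hHf (x : g) : ⁅H, x⁆ = f x := by
    rw [← LieDerivation.ad_apply_apply ℂ, hH]; rfl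
  refine ⟨H, mem_of_mem_rootSpaceOf_zero h fun K ↦ ?_, fun α x hx ↦ by rw [hHf, hf α x hx]⟩
  rw [← lie_skew, hHf, hf 0 _ (mem_rootSpaceOf_zero h K.2), hc0]
  simp

/-- A function on a positive system which is additive along root sums is evaluation at an element
of the Cartan subalgebra. -/
lemma exists_mem_cartan_of_additiveOn_positiveSystem {P : Set (Module.Dual ℂ h)}
    (hP : IsPositiveSystem h P) (c : Module.Dual ℂ h → ℂ)
    (hc : ∀ α ∈ P, ∀ β ∈ P, α + β ∈ P → c (α + β) = c α + c β) :
    ∃ H ∈ h, ∀ α ∈ P, ∀ x ∈ rootSpaceOf h α, ⁅H, x⁆ = c α • x := by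
  classical
  obtain ⟨hPr, hPneg, hPadd⟩ := hP
  let c' : Module.Dual ℂ h → ℂ := fun α ↦ if α ∈ P then c α else if -α ∈ P then -c (-α) else 0
  have h0P : (0 : Module.Dual ℂ h) ∉ P := fun h0 ↦ (hPr h0).1 rfl
  have c'_zero : c' 0 = 0 := by simp [c', h0P]
  have c'_pos {α} (hα : α ∈ P) : c' α = c α := if_pos hα
  have c'_neg (α) : c' (-α) = -c' α := by
    by_cases h1 : α ∈ P
    · simp [c', h1, (hPneg α (hPr h1)).mp h1]
    · by_cases h2 : -α ∈ P <;> simp [c', h1, h2]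
  have pos_pos {α β} (hα : α ∈ P) (hβ : β ∈ P) (hαβ : α + β ∈ P) :
      c' (α + β) = c' α + c' β := by
    rw [c'_pos hα, c'_pos hβ, c'_pos hαβ, hc α hα β hβ hαβ]
  have pos_or_neg {α} (hα : α ∈ rootsOf h) : α ∈ P ∨ -α ∈ P := by
    have := hPneg α hα
    tauto
  have pos_left {α β} (hα : α ∈ P) (hβ : β ∈ rootsOf h) (hαβ : α + β ∈ rootsOf h) :
      c' (α + β) = c' α + c' β := by
    rcases pos_or_neg hβ with hβ | hβ
    · exact pos_pos hα hβ (hPadd α hα β hβ hαβ)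
    rcases pos_or_neg hαβ with hγ | hγ
    · have := pos_pos hγ hβ (by simpa using hα)
      rw [c'_neg, add_neg_cancel_right] at this
      rw [this]; ring
    · have := pos_pos hα hγ (by simpa using hβ)
      rw [show α + -(α + β) = -β by abel, c'_neg, c'_neg] at this
      linear_combination this
  obtain ⟨H, hH, hHc⟩ := exists_mem_cartan_of_additive c' c'_zero fun α β hα hβ hαβ ↦ by
    rcases eq_or_ne α 0 with rfl | hα0
    · simp [c'_zero]
    rcases eq_or_ne β 0 with rfl | hβ0
    · simp [c'_zero]
    rcases eq_or_ne (α + β) 0 with hs | hs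
    · rw [hs, eq_neg_of_add_eq_zero_right hs, c'_neg, c'_zero]; ring
    rcases pos_or_neg ⟨hα0, hα⟩ with h1 | h1
    · exact pos_left h1 ⟨hβ0, hβ⟩ ⟨hs, hαβ⟩
    · have := pos_left h1 (neg_mem_rootsOf ⟨hβ0, hβ⟩)
        (by rw [← neg_add]; exact neg_mem_rootsOf ⟨hs, hαβ⟩)
      rw [← neg_add, c'_neg, c'_neg, c'_neg] at this
      linear_combination -this
  exact ⟨H, hH, fun α hα x hx ↦ by rw [hHc α x hx, c'_pos hα]⟩

end RootSpaces

/-- The derivation of a subalgebra `n` induced by an element normalizing it. -/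
def LieDerivation.ofNormalizer (n : LieSubalgebra ℂ g) (H : g) (hH : ∀ y ∈ n, ⁅H, y⁆ ∈ n) :
    LieDerivation ℂ n n where
  toLinearMap := (LieAlgebra.ad ℂ g H).restrict hH
  leibniz' a b := by
    ext
    change ⁅H, ⁅(a : g), (b : g)⁆⁆ = ⁅(a : g), ⁅H, (b : g)⁆⁆ - ⁅(b : g), ⁅H, (a : g)⁆⁆
    rw [leibniz_lie, ← lie_skew (b : g), sub_neg_eq_add, add_comm]

/-- The derivations of a subalgebra `n` induced by bracketing with elements of a subalgebra `h`. -/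
def LieSubalgebra.adDerivations (h n : LieSubalgebra ℂ g) :
    LieSubalgebra ℂ (LieDerivation ℂ n n) where
  carrier := {D | ∃ H ∈ h, ∀ y : n, ((D y : n) : g) = ⁅H, (y : g)⁆}
  add_mem' := by
    rintro D D' ⟨H, hH, hD⟩ ⟨H', hH', hD'⟩
    exact ⟨H + H', h.add_mem hH hH', fun y ↦ by simp [hD, hD']⟩
  zero_mem' := ⟨0, h.zero_mem, by simp⟩
  smul_mem' := by
    rintro c D ⟨H, hH, hD⟩
    exact ⟨c • H, h.smul_mem c hH, fun y ↦ by simp [hD]⟩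
  lie_mem' := by
    rintro D D' ⟨H, hH, hD⟩ ⟨H', hH', hD'⟩
    exact ⟨⁅H, H'⁆, h.lie_mem hH hH', fun y ↦ by
      simp [hD, hD', lie_lie]⟩

/-- **`ad(𝔥)` is a maximal abelian semisimple subalgebra of `Der(𝔫)`.**
Let `𝔤` be a finite-dimensional complex semisimple Lie algebra, `𝔥` a Cartan subalgebra,
`Δ⁺` a positive system, and `𝔫 = ⊕_{α ∈ Δ⁺} 𝔤_α` the nilradical of the associated Borel
subalgebra.  Then `𝔥̃ = {(ad_𝔤 H)|_𝔫 : H ∈ 𝔥}` is an abelian Lie subalgebra of `Der(𝔫)`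
consisting of diagonalizable endomorphisms, and is maximal among such subalgebras. -/
theorem adH_maximal_abelian_semisimple_in_der
    {g : Type*} [LieRing g] [LieAlgebra ℂ g] [Module.Finite ℂ g] [LieAlgebra.IsKilling ℂ g]
    (h : LieSubalgebra ℂ g) (hh : h.IsCartanSubalgebra)
    (P : Set (Module.Dual ℂ h)) (hP : IsPositiveSystem h P)
    (n : LieSubalgebra ℂ g)
    (hn : (n : Submodule ℂ g) = ⨆ α ∈ P, rootSpaceOf h α) :
    ∃ ht : LieSubalgebra ℂ (LieDerivation ℂ n n),
      (ht : Set (LieDerivation ℂ n n)) =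
        {D | ∃ H ∈ h, ∀ y : n, ((D y : n) : g) = ⁅H, (y : g)⁆} ∧
      (∀ D ∈ ht, ∀ D' ∈ ht, ⁅D, D'⁆ = 0) ∧
      (∀ D ∈ ht, (⨆ μ : ℂ, Module.End.eigenspace (LieDerivation.toLinearMap D) μ) = ⊤) ∧
      ∀ l : LieSubalgebra ℂ (LieDerivation ℂ n n),
        (∀ D ∈ l, ∀ D' ∈ l, ⁅D, D'⁆ = 0) →
        (∀ D ∈ l, (⨆ μ : ℂ, Module.End.eigenspace (LieDerivation.toLinearMap D) μ) = ⊤) →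
        ht ≤ l → l = ht := by
  have hle {α : Module.Dual ℂ h} (hα : α ∈ P) {x : g} (hx : x ∈ rootSpaceOf h α) : x ∈ n := by
    rw [← LieSubalgebra.mem_toSubmodule, hn]
    exact Submodule.mem_iSup_of_mem α (Submodule.mem_iSup_of_mem hα hx)
  have map_subtype_eq_top {q : Submodule ℂ n}
      (hq : ∀ α ∈ P, ∀ x (hx : x ∈ n), x ∈ rootSpaceOf h α → (⟨x, hx⟩ : n) ∈ q) : q = ⊤ := by
    have : (n : Submodule ℂ g) ≤ q.map (n : Submodule ℂ g).subtype := by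
      conv_lhs => rw [hn]
      exact iSup₂_le fun α hα x hx ↦ ⟨⟨x, hle hα hx⟩, hq α hα x _ hx, rfl⟩
    refine eq_top_iff.mpr fun y _ ↦ ?_
    obtain ⟨z, hz, hzy⟩ := this y.2
    exact (Subtype.ext hzy : z = y) ▸ hz
  have hnorm {H : g} (hH : H ∈ h) : ∀ y ∈ n, ⁅H, y⁆ ∈ n := by
    intro y hy
    have := map_subtype_eq_top
      (q := ((n : Submodule ℂ g).comap (LieAlgebra.ad ℂ g H)).comap (n : Submodule ℂ g).subtype)
      fun α hα x hx hxα ↦ by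
        change ⁅H, x⁆ ∈ n
        rw [show ⁅H, x⁆ = α ⟨H, hH⟩ • x from hxα ⟨H, hH⟩]
        exact n.smul_mem _ hx
    have hy' : (⟨y, hy⟩ : n) ∈ (⊤ : Submodule ℂ n) := Submodule.mem_top
    rw [← this] at hy'
    exact hy'
  refine ⟨h.adDerivations n, rfl, ?_, ?_, ?_⟩
  · rintro D ⟨H, hH, hD⟩ D' ⟨H', hH', hD'⟩
    ext y
    have hHH' : ⁅H, H'⁆ = 0 :=
      congrArg Subtype.val (trivial_lie_zero h h (⟨H, hH⟩ : h) ⟨H', hH'⟩)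
    simp [hD, hD', ← lie_lie, hHH']
  · rintro D ⟨H, hH, hD⟩
    refine map_subtype_eq_top fun α hα x hx hxα ↦ ?_
    refine Submodule.mem_iSup_of_mem (α ⟨H, hH⟩) (Module.End.mem_eigenspace_iff.mpr ?_)
    exact Subtype.ext ((hD ⟨x, hx⟩).trans (hxα ⟨H, hH⟩))
  · refine fun l hab _ hl ↦ le_antisymm (fun D hD ↦ ?_) hl
    have hcomm {H : g} (hH : H ∈ h) (y : n) :
        ⁅H, ((D y : n) : g)⁆ = D ⟨⁅H, (y : g)⁆, hnorm hH y y.2⟩ := by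
      have h0 := hab _ (hl (show LieDerivation.ofNormalizer n H (hnorm hH) ∈ h.adDerivations n from
        ⟨H, hH, fun _ ↦ rfl⟩)) D hD
      have h1 := DFunLike.congr_fun h0 y
      rw [LieDerivation.commutator_apply, LieDerivation.zero_apply, sub_eq_zero] at h1
      exact congrArg Subtype.val h1
    have hpres {α : Module.Dual ℂ h} (x : n) (hx : (x : g) ∈ rootSpaceOf h α) :
        ((D x : n) : g) ∈ rootSpaceOf h α := by
      intro H
      rw [hcomm H.2 x, show (⟨⁅(H : g), (x : g)⁆, hnorm H.2 x x.2⟩ : n) = α H • x from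
        Subtype.ext (hx H), map_smul]
      rfl
    have hscal (α : Module.Dual ℂ h) : ∃ c : ℂ, α ∈ P → ∀ x : n, (x : g) ∈ rootSpaceOf h α →
        D x = c • x := by
      by_cases hα : α ∈ P
      · let f : rootSpaceOf h α →ₗ[ℂ] rootSpaceOf h α :=
          { toFun x := ⟨D ⟨x, hle hα x.2⟩, hpres _ x.2⟩
            map_add' x y := Subtype.ext (congrArg (Subtype.val : n → g)
              (map_add D ⟨x, hle hα x.2⟩ ⟨y, hle hα y.2⟩))
            map_smul' a x := Subtype.ext (congrArg (Subtype.val : n → g)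
              (map_smul D a ⟨x, hle hα x.2⟩)) }
        obtain ⟨c, hc⟩ := exists_smul_eq_of_mapsTo_rootSpaceOf (hP.1 hα) f
        exact ⟨c, fun _ x hx ↦ Subtype.ext (congrArg (Subtype.val : rootSpaceOf h α → g) (hc ⟨x, hx⟩))⟩
      · exact ⟨0, fun h' ↦ absurd h' hα⟩
    choose c hc using hscal
    obtain ⟨H, hH, hHc⟩ := exists_mem_cartan_of_additiveOn_positiveSystem hP c
      fun α hα β hβ hαβ ↦ by
        obtain ⟨x, hx, y, hy, hxy⟩ :=
          exists_lie_ne_zero_of_add_mem_rootsOf (hP.1 hα) (hP.1 hβ) (hP.1 hαβ)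
        let x' : n := ⟨x, hle hα hx⟩
        let y' : n := ⟨y, hle hβ hy⟩
        have hxy' : ⁅x', y'⁆ ≠ 0 := fun h0 ↦ hxy (congrArg Subtype.val h0)
        have h1 := hc (α + β) hαβ ⁅x', y'⁆ (lie_mem_rootSpaceOf_add hx hy)
        rw [LieDerivation.apply_lie_eq_add, hc α hα x' hx, hc β hβ y' hy, lie_smul, smul_lie,
          ← add_smul] at h1
        rw [← smul_left_injective ℂ hxy' h1, add_comm]
    refine ⟨H, hH, fun y ↦ ?_⟩
    have := map_subtype_eq_top
      (q := LinearMap.eqLocus D.toLinearMap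
        (LieDerivation.ofNormalizer n H (hnorm hH)).toLinearMap)
      fun α hα x hx hxα ↦ Subtype.ext <| by
        change ((D ⟨x, hx⟩ : n) : g) = ⁅H, x⁆
        rw [hc α hα ⟨x, hx⟩ hxα, hHc α hα x hxα]
        rfl
    exact congrArg Subtype.val (this ▸ Submodule.mem_top :
      y ∈ LinearMap.eqLocus D.toLinearMap
        (LieDerivation.ofNormalizer n H (hnorm hH)).toLinearMap)
end
end
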